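/- arXiv:2111.02761 — 3 statements merged into one kernel-verified Lean document; each statement's English description precedes it below -/
import Mathlib

section
/- Define ℓ_hom : [0,T) → [L0,L] by ℓ_hom(t) = inf{ l ∈ [L0,L] : f(t)²·𝒢_hom(l) < Gc_eff(l) }, the effective dissipated energy D_eff(l) = ∫_{L0}^{l} Gc_eff(s) ds (Lebesgue integral of the measurable [0,+∞]-valued function Gc_eff), and F(t,l) = f(t)²·E_hom(l) + D_eff(l). Then for every t ∈ [0,T) all quantities below are finite and the energy identity holds: F(t,ℓ_hom(t)) = ∫₀ᵗ 2 f(τ) f'(τ) E_hom(ℓ_hom(τ)) dτ + Σ_{τ ∈ J(ℓ_hom) ∩ [0,t]} ( F(τ,ℓ_hom(τ)) − F(τ,ℓ_hom⁻(τ)) ), where J(ℓ_hom) is the (at most countable) set of jump points of ℓ_hom, ℓ_hom⁻(τ) the left limit (with ℓ_hom⁻(0) := L0), and each summand is ≤ 0. -/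
open Set Filter Topology MeasureTheory
open scoped ENNReal

/-- The quasi-static evolution `ℓ(t) = inf { l ∈ [L0,L] : G(t,l) < Gc(l) }`,
where `G(t,l) = f(t)² · 𝒢(l)` (computed in `ℝ≥0∞`). -/
noncomputable def griffithEvolution (L0 L : ℝ) (f : ℝ → ℝ) (Gr : ℝ → ℝ≥0∞)
    (Gc : ℝ → ℝ) (t : ℝ) : ℝ :=
  sInf {l | l ∈ Set.Icc L0 L ∧ ENNReal.ofReal (f t ^ 2) * Gr l < ENNReal.ofReal (Gc l)}

/-- The Γ-lower limit at `l` of a sequence of functions `h n : (0,L] → ℝ≥0∞`: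
`(Γ-liminf h)(l) = inf { liminf_n h n (lₙ) : (lₙ) ⊆ (0,L], lₙ → l }`. -/
noncomputable def gammaLiminf (L : ℝ) (h : ℕ → ℝ → ℝ≥0∞) (l : ℝ) : ℝ≥0∞ :=
  ⨅ (seq : ℕ → ℝ) (_ : ∀ n, seq n ∈ Set.Ioc 0 L)
    (_ : Filter.Tendsto seq Filter.atTop (nhds l)),
    Filter.liminf (fun n => h n (seq n)) Filter.atTop

structure CoreHyp (L0 L T : ℝ) (κ κ' E G : ℝ → ℝ) (C : ℝ → ℝ≥0∞) (ℓ : ℝ → ℝ) : Prop where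
  hL : L0 < L
  hT : 0 < T
  k0 : κ 0 = 0
  kmono : MonotoneOn κ (Icc 0 T)
  kcont : ContinuousOn κ (Icc 0 T)
  kcont' : ContinuousOn κ' (Icc 0 T)
  kint : ∀ a ∈ Icc (0:ℝ) T, ∫ τ in (0:ℝ)..a, κ' τ = κ a
  Gnn : ∀ s ∈ Icc L0 L, 0 ≤ G s
  Gint : IntegrableOn G (Ioc L0 L)
  Geq : ∀ a ∈ Icc L0 L, ∀ b ∈ Icc L0 L, a ≤ b → ∫ s in a..b, G s = E a - E b
  Cmeas : AEMeasurable C (volume.restrict (Ioc L0 L))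
  CL : C L = ⊤
  Cpos : ∀ l ∈ Icc L0 L, 0 < C l
  Ccl : ∀ c : ℝ, 0 ≤ c → IsClosed {l | l ∈ Icc L0 L ∧ ENNReal.ofReal (c * G l) ≤ C l}
  hl : ∀ t, ℓ t = sInf {l | l ∈ Icc L0 L ∧ ENNReal.ofReal (κ t * G l) < C l}

namespace CoreHyp

variable {L0 L T : ℝ} {κ κ' E G : ℝ → ℝ} {C : ℝ → ℝ≥0∞} {ℓ : ℝ → ℝ}

lemma setbdd (t : ℝ) : BddBelow {l | l ∈ Icc L0 L ∧ ENNReal.ofReal (κ t * G l) < C l} :=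
  ⟨L0, fun _ hx => hx.1.1⟩

lemma setne (h : CoreHyp L0 L T κ κ' E G C ℓ) (t : ℝ) :
    L ∈ {l | l ∈ Icc L0 L ∧ ENNReal.ofReal (κ t * G l) < C l} := by
  refine ⟨⟨h.hL.le, le_rfl⟩, ?_⟩
  rw [h.CL]; exact ENNReal.ofReal_lt_top

lemma mem (h : CoreHyp L0 L T κ κ' E G C ℓ) (t : ℝ) : ℓ t ∈ Icc L0 L := by
  rw [h.hl]
  exact ⟨le_csInf ⟨L, h.setne t⟩ fun _ hx => hx.1.1, csInf_le (setbdd t) (h.setne t)⟩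

lemma le_of (h : CoreHyp L0 L T κ κ' E G C ℓ) {t l : ℝ} (hl : l ∈ Icc L0 L)
    (hP : ENNReal.ofReal (κ t * G l) < C l) : ℓ t ≤ l := by
  rw [h.hl]; exact csInf_le (setbdd t) ⟨hl, hP⟩

lemma le_of_lt (h : CoreHyp L0 L T κ κ' E G C ℓ) {t l : ℝ} (hl : l ∈ Icc L0 L)
    (hlt : l < ℓ t) : C l ≤ ENNReal.ofReal (κ t * G l) := by
  by_contra hc
  exact absurd (h.le_of hl (not_le.1 hc)) (not_le.2 hlt)

lemma exists_of_lt (h : CoreHyp L0 L T κ κ' E G C ℓ) {t s : ℝ} (hs : ℓ t < s) :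
    ∃ l ∈ Icc L0 L, l < s ∧ ENNReal.ofReal (κ t * G l) < C l := by
  rw [h.hl] at hs
  obtain ⟨l, hl, hls⟩ := (csInf_lt_iff (setbdd t) ⟨L, h.setne t⟩).1 hs
  exact ⟨l, hl.1, hls, hl.2⟩

lemma Pmono (h : CoreHyp L0 L T κ κ' E G C ℓ) {a b l : ℝ} (ha : a ∈ Icc 0 T) (hb : b ∈ Icc 0 T)
    (hab : a ≤ b) (hl : l ∈ Icc L0 L) :
    ENNReal.ofReal (κ a * G l) ≤ ENNReal.ofReal (κ b * G l) :=
  ENNReal.ofReal_le_ofReal (mul_le_mul_of_nonneg_right (h.kmono ha hb hab) (h.Gnn l hl))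

lemma mono (h : CoreHyp L0 L T κ κ' E G C ℓ) : MonotoneOn ℓ (Icc 0 T) := by
  intro a ha b hb hab
  rw [h.hl b]
  refine le_csInf ⟨L, h.setne b⟩ fun l hl => ?_
  exact h.le_of hl.1 ((h.Pmono ha hb hab hl.1).trans_lt hl.2)

lemma zero (h : CoreHyp L0 L T κ κ' E G C ℓ) : ℓ 0 = L0 := by
  have hm : L0 ∈ Icc L0 L := ⟨le_rfl, h.hL.le⟩
  refine le_antisymm (h.le_of hm ?_) (h.mem 0).1
  simpa [h.k0] using h.Cpos L0 hm

lemma knn (h : CoreHyp L0 L T κ κ' E G C ℓ) {a : ℝ} (ha : a ∈ Icc 0 T) : 0 ≤ κ a := by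
  rw [← h.k0]; exact h.kmono ⟨le_rfl, h.hT.le⟩ ha ha.1

lemma Popen (h : CoreHyp L0 L T κ κ' E G C ℓ) {τ t l : ℝ} (h0 : 0 ≤ τ) (hτ : τ < t) (ht : t ≤ T)
    (hP : ENNReal.ofReal (κ τ * G l) < C l) :
    ∃ b, τ < b ∧ b ≤ t ∧ ∀ x ∈ Ioo τ b, ENNReal.ofReal (κ x * G l) < C l := by
  have hc : ContinuousWithinAt (fun x => ENNReal.ofReal (κ x * G l)) (Icc 0 T) τ :=
    ENNReal.continuous_ofReal.continuousAt.comp_continuousWithinAt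
      ((h.kcont τ ⟨h0, by linarith⟩).mul_const _)
  have h1 : ∀ᶠ x in 𝓝[Ioo τ t] τ, ENNReal.ofReal (κ x * G l) < C l :=
    (hc.mono (fun x hx => ⟨by linarith [hx.1], by linarith [hx.2]⟩)).eventually_lt
      continuousWithinAt_const hP
  rw [nhdsWithin_Ioo_eq_nhdsGT hτ] at h1
  obtain ⟨b, hb, hb2⟩ := (mem_nhdsGT_iff_exists_Ioo_subset' hτ).1 h1
  refine ⟨min b t, lt_min hb hτ, min_le_right _ _, fun x hx => hb2 ⟨hx.1, hx.2.trans_le (min_le_left _ _)⟩⟩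

/-- left limit -/
noncomputable def lm (L0 : ℝ) (ℓ : ℝ → ℝ) (t : ℝ) : ℝ := if t = 0 then L0 else sSup (ℓ '' Set.Ico 0 t)

lemma bddA (h : CoreHyp L0 L T κ κ' E G C ℓ) (t : ℝ) : BddAbove (ℓ '' Set.Ico 0 t) :=
  ⟨L, by rintro _ ⟨x, -, rfl⟩; exact (h.mem x).2⟩

lemma le_lm (h : CoreHyp L0 L T κ κ' E G C ℓ) {a t : ℝ} (ha : 0 ≤ a) (hat : a < t) :
    ℓ a ≤ lm L0 ℓ t := by
  rw [lm, if_neg (by linarith)]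
  exact le_csSup (h.bddA t) ⟨a, ⟨ha, hat⟩, rfl⟩

lemma lm_le {t s : ℝ} (ht : 0 < t)
    (hs : ∀ a, 0 ≤ a → a < t → ℓ a ≤ s) : lm L0 ℓ t ≤ s := by
  rw [lm, if_neg ht.ne']
  refine csSup_le ⟨_, 0, ⟨le_rfl, ht⟩, rfl⟩ ?_
  rintro _ ⟨x, hx, rfl⟩
  exact hs x hx.1 hx.2

lemma lm_le_self (h : CoreHyp L0 L T κ κ' E G C ℓ) {t : ℝ} (ht : t ∈ Icc 0 T) : lm L0 ℓ t ≤ ℓ t := by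
  rcases ht.1.eq_or_lt with rfl | h0
  · simp [lm, h.zero]
  · exact lm_le h0 fun a ha hat => h.mono ⟨ha, by linarith [ht.2]⟩ ht hat.le

lemma lm_ge (h : CoreHyp L0 L T κ κ' E G C ℓ) {t : ℝ} (ht : 0 ≤ t) : L0 ≤ lm L0 ℓ t := by
  rcases ht.eq_or_lt with rfl | h0
  · simp [lm]
  · rw [← h.zero]; exact h.zero ▸ h.le_lm le_rfl h0

lemma disj (h : CoreHyp L0 L T κ κ' E G C ℓ) {a b : ℝ} (ha : a ∈ Ico 0 T) (hb : b ∈ Ico 0 T)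
    (hab : a ≠ b) : Disjoint (Ioc (lm L0 ℓ a) (ℓ a)) (Ioc (lm L0 ℓ b) (ℓ b)) := by
  wlog hlt : a < b generalizing a b
  · exact (this hb ha hab.symm (lt_of_le_of_ne (not_lt.1 hlt) hab.symm)).symm
  have := h.le_lm ha.1 hlt
  rw [Set.disjoint_left]
  intro x hx hy
  linarith [hx.2, hy.1]

lemma countable (h : CoreHyp L0 L T κ κ' E G C ℓ) :
    {τ | τ ∈ Set.Ico 0 T ∧ lm L0 ℓ τ ≠ ℓ τ}.Countable := by
  refine Set.PairwiseDisjoint.countable_of_isOpen (s := fun τ => Ioo (lm L0 ℓ τ) (ℓ τ)) ?_ ?_ ?_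
  · intro a ha b hb hab
    exact (h.disj ha.1 hb.1 hab).mono Ioo_subset_Ioc_self Ioo_subset_Ioc_self
  · intro a _
    exact isOpen_Ioo
  · intro a ha
    exact nonempty_Ioo.2 (lt_of_le_of_ne (h.lm_le_self ⟨ha.1.1, ha.1.2.le⟩) ha.2)

/-- inverse time -/
noncomputable def ts (ℓ : ℝ → ℝ) (t s : ℝ) : ℝ := sSup {τ | τ ∈ Icc 0 t ∧ ℓ τ < s}

lemma ts_bdd (t s : ℝ) : BddAbove {τ | τ ∈ Icc 0 t ∧ ℓ τ < s} := ⟨t, fun _ hx => hx.1.2⟩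

lemma ts_mem (h : CoreHyp L0 L T κ κ' E G C ℓ) {t s : ℝ} (ht : 0 ≤ t) (hs : L0 < s) :
    ts ℓ t s ∈ Icc 0 t := by
  have h0 : (0:ℝ) ∈ {τ | τ ∈ Icc 0 t ∧ ℓ τ < s} := ⟨⟨le_rfl, ht⟩, by rwa [h.zero]⟩
  exact ⟨le_csSup (ts_bdd t s) h0, csSup_le ⟨_, h0⟩ fun _ hx => hx.1.2⟩

lemma lt_of_lt_ts (h : CoreHyp L0 L T κ κ' E G C ℓ) {t s a : ℝ} (ht : t ∈ Ico 0 T) (hs : L0 < s)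
    (ha : 0 ≤ a) (hat : a < ts ℓ t s) : ℓ a < s := by
  have h0 : (0:ℝ) ∈ {τ | τ ∈ Icc 0 t ∧ ℓ τ < s} := ⟨⟨le_rfl, ht.1⟩, by rwa [h.zero]⟩
  obtain ⟨b, hb, hab⟩ := exists_lt_of_lt_csSup ⟨_, h0⟩ hat
  exact (h.mono ⟨ha, by linarith [hb.1.2, ht.2]⟩ ⟨hb.1.1, by linarith [hb.1.2, ht.2]⟩ hab.le).trans_lt hb.2

lemma ge_of_ts_lt {t s a : ℝ} (ha : 0 ≤ a) (hat : a ≤ t)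
    (hts : ts ℓ t s < a) : s ≤ ℓ a := by
  by_contra hc
  exact absurd (le_csSup (ts_bdd t s) ⟨⟨ha, hat⟩, not_le.1 hc⟩) (not_le.2 hts)

lemma ge_ts (h : CoreHyp L0 L T κ κ' E G C ℓ) {t s : ℝ} (ht : t ∈ Ico 0 T) (hs : L0 < s)
    (hst : s ≤ ℓ t) : s ≤ ℓ (ts ℓ t s) := by
  have hm := h.ts_mem ht.1 hs
  rcases hm.2.eq_or_lt with he | hlt
  · rwa [he]
  by_contra hc
  obtain ⟨l, hl, hls, hP⟩ := h.exists_of_lt (not_le.1 hc)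
  obtain ⟨b, hb, hbt, hb2⟩ := h.Popen hm.1 hlt ht.2.le hP
  obtain ⟨x, hx⟩ := exists_between hb
  have h1 := h.le_of hl (hb2 x hx)
  have h2 : s ≤ ℓ x := ge_of_ts_lt (by linarith [hm.1, hx.1]) (by linarith [hx.2]) hx.1
  linarith

lemma ts_pos (h : CoreHyp L0 L T κ κ' E G C ℓ) {t s : ℝ} (ht : t ∈ Ico 0 T) (hs : L0 < s)
    (hst : s ≤ ℓ t) : 0 < ts ℓ t s := by
  have hm := h.ts_mem ht.1 hs
  refine lt_of_le_of_ne hm.1 fun he => ?_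
  have := h.ge_ts ht hs hst
  rw [← he, h.zero] at this
  linarith

/-- on jump intervals the inverse time is the jump time -/
lemma ts_jump (h : CoreHyp L0 L T κ κ' E G C ℓ) {t s τ : ℝ} (ht : t ∈ Ico 0 T) (hτ : τ ∈ Icc 0 t)
    (hs : s ∈ Ioc (lm L0 ℓ τ) (ℓ τ)) : ts ℓ t s = τ := by
  have hs0 : L0 < s := (h.lm_ge hτ.1).trans_lt hs.1
  have hm := h.ts_mem ht.1 hs0
  apply le_antisymm
  · by_contra hc
    exact absurd (h.lt_of_lt_ts ht hs0 hτ.1 (not_le.1 hc)) (not_lt.2 hs.2)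
  · by_contra hc
    obtain ⟨x, hx⟩ := exists_between (not_le.1 hc)
    have h1 : s ≤ ℓ x := ge_of_ts_lt (by linarith [hm.1, hx.1]) (by linarith [hx.2, hτ.2]) hx.1
    have h2 := h.le_lm (by linarith [hm.1, hx.1]) hx.2
    linarith [hs.1]

/-- off jumps -/
lemma off_jump (h : CoreHyp L0 L T κ κ' E G C ℓ) {t s : ℝ} (ht : t ∈ Ico 0 T) (hs : L0 < s)
    (hst : s < ℓ t) (hoff : ∀ τ ∈ Icc 0 t, s ∉ Ioc (lm L0 ℓ τ) (ℓ τ))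
    (hq : s ∉ ℓ '' (range ((↑) : ℚ → ℝ))) :
    C s = ENNReal.ofReal (κ (ts ℓ t s) * G s) := by
  have hm := h.ts_mem ht.1 hs
  have hpos := h.ts_pos ht hs hst.le
  have hge := h.ge_ts ht hs hst.le
  have hsm : s ∈ Icc L0 L := ⟨hs.le, hst.le.trans (h.mem t).2⟩
  have hlm : s ≤ lm L0 ℓ (ts ℓ t s) := by
    by_contra hc
    exact hoff _ hm ⟨not_le.1 hc, hge⟩
  have hmT : ts ℓ t s ∈ Icc 0 T := ⟨hm.1, hm.2.trans ht.2.le⟩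
  apply le_antisymm
  · rcases hge.eq_or_lt with he | hlt
    · by_contra hc
      have htst : ts ℓ t s < t := by
        refine lt_of_le_of_ne hm.2 fun h' => ?_
        rw [h'] at he; linarith
      obtain ⟨b, hb, hbt, hb2⟩ := h.Popen hm.1 htst ht.2.le (not_le.1 hc)
      obtain ⟨q, hq1, hq2⟩ := exists_rat_btwn hb
      refine hq ⟨q, ⟨q, rfl⟩, le_antisymm (h.le_of hsm (hb2 q ⟨hq1, hq2⟩)) ?_⟩
      exact ge_of_ts_lt (by linarith [hm.1]) (by linarith) hq1
    · exact h.le_of_lt hsm hlt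
  · have key : ∀ a ∈ Ico 0 (ts ℓ t s), ENNReal.ofReal (κ a * G s) ≤ C s := by
      intro a ha
      have haT : a ∈ Icc 0 T := ⟨ha.1, by linarith [ha.2, hmT.2]⟩
      have hcl := h.Ccl (κ a) (h.knn haT)
      suffices s ∈ closure {l | l ∈ Icc L0 L ∧ ENNReal.ofReal (κ a * G l) ≤ C l} by
        rw [hcl.closure_eq] at this; exact this.2
      rw [Metric.mem_closure_iff]
      intro ε hε
      have h1 : s - ε < sSup (ℓ '' Set.Ico 0 (ts ℓ t s)) := by
        rw [lm, if_neg hpos.ne'] at hlm; linarith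
      obtain ⟨_, ⟨b, hb, rfl⟩, hbs⟩ := exists_lt_of_lt_csSup
        ((nonempty_Ico.2 hpos).image ℓ) h1
      have hc : max a b < ts ℓ t s := max_lt ha.2 hb.2
      have hc0 : 0 ≤ max a b := ha.1.trans (le_max_left _ _)
      have hcT : max a b ∈ Icc 0 T := ⟨hc0, by linarith [hmT.2]⟩
      obtain ⟨l, hl, hls, hP⟩ := h.exists_of_lt (h.lt_of_lt_ts ht hs hc0 hc)
      have h2 := h.le_of hl hP
      have h3 := h.mono ⟨hb.1, by linarith [hb.2, hmT.2]⟩ hcT (le_max_right a b)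
      refine ⟨l, ⟨hl, (h.Pmono haT hcT (le_max_left _ _) hl).trans hP.le⟩, ?_⟩
      rw [Real.dist_eq, abs_lt]; constructor <;> linarith
    have hc : ContinuousWithinAt (fun x => ENNReal.ofReal (κ x * G s)) (Icc 0 T) (ts ℓ t s) :=
      ENNReal.continuous_ofReal.continuousAt.comp_continuousWithinAt
        ((h.kcont _ hmT).mul_const _)
    have hc2 := hc.mono (s := Ico 0 (ts ℓ t s)) fun x hx => ⟨hx.1, by linarith [hx.2, hmT.2]⟩
    have : (𝓝[Ico 0 (ts ℓ t s)] (ts ℓ t s)).NeBot := by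
      rw [← mem_closure_iff_nhdsWithin_neBot, closure_Ico hpos.ne]
      exact ⟨hm.1, le_rfl⟩
    exact le_of_tendsto hc2 (eventually_mem_nhdsWithin.mono key)

lemma ioc_sub (h : CoreHyp L0 L T κ κ' E G C ℓ) (t : ℝ) : Ioc L0 (ℓ t) ⊆ Ioc L0 L :=
  Ioc_subset_Ioc_right (h.mem t).2

lemma ae_le (h : CoreHyp L0 L T κ κ' E G C ℓ) (t : ℝ) :
    ∀ᵐ s ∂(volume.restrict (Ioc L0 (ℓ t))), C s ≤ ENNReal.ofReal (κ t * G s) := by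
  rw [ae_restrict_iff' measurableSet_Ioc]
  have : ∀ᵐ s : ℝ, s ≠ ℓ t := by simp [ae_iff]
  filter_upwards [this] with s hs hs2
  exact h.le_of_lt ⟨hs2.1.le, hs2.2.trans (h.mem t).2⟩ (lt_of_le_of_ne hs2.2 hs)

lemma finite (h : CoreHyp L0 L T κ κ' E G C ℓ) (t : ℝ) : ∫⁻ s in Ioc L0 (ℓ t), C s ≠ ⊤ := by
  refine ((lintegral_mono_ae (h.ae_le t)).trans_lt ?_).ne
  exact Integrable.lintegral_lt_top ((h.Gint.mono_set (h.ioc_sub t)).const_mul (κ t))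

lemma cint (h : CoreHyp L0 L T κ κ' E G C ℓ) (t : ℝ) :
    IntegrableOn (fun s => (C s).toReal) (Ioc L0 (ℓ t)) :=
  integrable_toReal_of_lintegral_ne_top
    (h.Cmeas.mono_measure (Measure.restrict_mono (h.ioc_sub t) le_rfl)) (h.finite t)

lemma deq (h : CoreHyp L0 L T κ κ' E G C ℓ) {t b : ℝ} (hb : b ≤ ℓ t) :
    (∫⁻ s in Ioc L0 b, C s).toReal = ∫ s in Ioc L0 b, (C s).toReal := by
  have hsub : Ioc L0 b ⊆ Ioc L0 (ℓ t) := Ioc_subset_Ioc_right hb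
  rw [integral_toReal]
  · exact h.Cmeas.mono_measure (Measure.restrict_mono (hsub.trans (h.ioc_sub t)) le_rfl)
  · have := ae_mono (Measure.restrict_mono hsub le_rfl) (h.ae_le t)
    filter_upwards [this] with s hs
    exact hs.trans_lt ENNReal.ofReal_lt_top

lemma fub (h : CoreHyp L0 L T κ κ' E G C ℓ) {t : ℝ} (ht : t ∈ Ico 0 T) :
    IntegrableOn (fun s => G s * κ (ts ℓ t s)) (Ioc L0 (ℓ t)) ∧
    κ t * E (ℓ t) - ∫ τ in (0:ℝ)..t, κ' τ * E (ℓ τ) =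
      - ∫ s in Ioc L0 (ℓ t), G s * κ (ts ℓ t s) := by
  have ht0 := ht.1
  set ℓc : ℝ → ℝ := fun τ => ℓ (max 0 (min τ t)) with hℓc
  have hcl : ∀ τ, max 0 (min τ t) ∈ Icc 0 T := fun τ =>
    ⟨le_max_left _ _, max_le h.hT.le ((min_le_right _ _).trans ht.2.le)⟩
  have hmono : Monotone ℓc := fun a b hab =>
    h.mono (hcl a) (hcl b) (max_le_max le_rfl (min_le_min hab le_rfl))
  have hce : ∀ τ ∈ Ioc 0 t, ℓc τ = ℓ τ := fun τ hτ => by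
    simp [hℓc, hτ.2, hτ.1.le]
  have hκ : IntegrableOn κ' (Ioc 0 t) :=
    ((h.kcont'.mono (Icc_subset_Icc_right ht.2.le)).integrableOn_Icc).mono_set Ioc_subset_Icc_self
  have hG : IntegrableOn G (Ioc L0 (ℓ t)) := h.Gint.mono_set (h.ioc_sub t)
  set A : Set (ℝ × ℝ) := {p | ℓc p.1 < p.2} with hA
  have hAm : MeasurableSet A :=
    measurableSet_lt (hmono.measurable.comp measurable_fst) measurable_snd
  set Φ : ℝ → ℝ → ℝ := fun τ s => A.indicator (fun p => κ' p.1 * G p.2) (τ, s) with hΦ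
  have hint : Integrable (Function.uncurry Φ)
      ((volume.restrict (Ioc 0 t)).prod (volume.restrict (Ioc L0 (ℓ t)))) :=
    (Integrable.mul_prod hκ hG).indicator hAm
  have e1 : ∀ τ ∈ Ioc 0 t, ∫ s in Ioc L0 (ℓ t), Φ τ s = κ' τ * (E (ℓ τ) - E (ℓ t)) := by
    intro τ hτ
    have hle : ℓ τ ≤ ℓ t := h.mono ⟨hτ.1.le, hτ.2.trans ht.2.le⟩ ⟨ht0, ht.2.le⟩ hτ.2
    have : ∀ s, Φ τ s = (Ioi (ℓ τ)).indicator (fun s => κ' τ * G s) s := by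
      intro s
      simp only [hΦ, hA, indicator, mem_ofPred_eq, mem_Ioi, hce τ hτ]
    simp_rw [this]
    rw [setIntegral_indicator measurableSet_Ioi, Ioc_inter_Ioi, sup_eq_right.2 (h.mem τ).1,
      integral_const_mul, ← intervalIntegral.integral_of_le hle,
      h.Geq _ (h.mem τ) _ (h.mem t) hle]
  have e2 : ∀ s ∈ Ioc L0 (ℓ t), ∫ τ in Ioc 0 t, Φ τ s = G s * κ (ts ℓ t s) := by
    intro s hs
    have hm := h.ts_mem ht0 hs.1
    have : ∫ τ in Ioc 0 t, Φ τ s =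
        ∫ τ in Ioc 0 t, (Iic (ts ℓ t s)).indicator (fun τ => κ' τ * G s) τ := by
      refine setIntegral_congr_ae measurableSet_Ioc ?_
      have : ∀ᵐ τ : ℝ, τ ≠ ts ℓ t s := by simp [ae_iff]
      filter_upwards [this] with τ hne hτ
      simp only [hΦ, hA, indicator, mem_ofPred_eq, mem_Iic, hce τ hτ]
      rcases lt_or_gt_of_ne hne with hlt | hlt
      · rw [if_pos (h.lt_of_lt_ts ht hs.1 hτ.1.le hlt), if_pos hlt.le]
      · rw [if_neg (not_lt.2 (ge_of_ts_lt hτ.1.le hτ.2 hlt)), if_neg (not_le.2 hlt)]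
    rw [this, setIntegral_indicator measurableSet_Iic, Ioc_inter_Iic, inf_eq_right.2 hm.2,
      integral_mul_const, ← intervalIntegral.integral_of_le hm.1,
      h.kint _ ⟨hm.1, hm.2.trans ht.2.le⟩, mul_comm]
  have i1 : IntegrableOn (fun τ => κ' τ * (E (ℓ τ) - E (ℓ t))) (Ioc 0 t) := by
    refine IntegrableOn.congr_fun (f := fun τ => ∫ s in Ioc L0 (ℓ t), Φ τ s) ?_ e1 measurableSet_Ioc
    exact hint.integral_prod_left
  have i2 : IntegrableOn (fun s => G s * κ (ts ℓ t s)) (Ioc L0 (ℓ t)) := by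
    refine IntegrableOn.congr_fun (f := fun s => ∫ τ in Ioc 0 t, Φ τ s) ?_ e2 measurableSet_Ioc
    exact hint.integral_prod_right
  refine ⟨i2, ?_⟩
  have hsw := integral_integral_swap hint
  rw [setIntegral_congr_fun measurableSet_Ioc e1, setIntegral_congr_fun measurableSet_Ioc e2] at hsw
  have e3 : ∫ τ in Ioc 0 t, κ' τ * E (ℓ τ) =
      (∫ τ in Ioc 0 t, κ' τ * (E (ℓ τ) - E (ℓ t))) + ∫ τ in Ioc 0 t, κ' τ * E (ℓ t) := by
    rw [← integral_add i1 (hκ.mul_const _)]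
    congr 1; ext τ; ring
  rw [integral_mul_const, ← intervalIntegral.integral_of_le ht0 (f := κ'), h.kint t ⟨ht0, ht.2.le⟩] at e3
  rw [intervalIntegral.integral_of_le ht0, e3, hsw]
  ring

lemma jump (h : CoreHyp L0 L T κ κ' E G C ℓ) {t τ : ℝ} (ht : t ∈ Ico 0 T) (hτ : τ ∈ Icc 0 t) :
    (κ τ * E (ℓ τ) + (∫⁻ s in Ioc L0 (ℓ τ), C s).toReal) -
      (κ τ * E (lm L0 ℓ τ) + (∫⁻ s in Ioc L0 (lm L0 ℓ τ), C s).toReal) =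
    ∫ s in Ioc (lm L0 ℓ τ) (ℓ τ), ((C s).toReal - G s * κ τ) := by
  have hτT : τ ∈ Icc 0 T := ⟨hτ.1, hτ.2.trans ht.2.le⟩
  have hle := h.lm_le_self hτT
  have hge := h.lm_ge hτ.1
  have hsub : Ioc (lm L0 ℓ τ) (ℓ τ) ⊆ Ioc L0 (ℓ τ) := Ioc_subset_Ioc_left hge
  have hG := h.Gint.mono_set (hsub.trans (h.ioc_sub τ))
  have hc := (h.cint τ).mono_set hsub
  rw [h.deq (t := τ) le_rfl, h.deq hle, integral_sub hc (hG.mul_const _), integral_mul_const,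
    ← intervalIntegral.integral_of_le hle (f := G),
    h.Geq _ ⟨hge, hle.trans (h.mem τ).2⟩ _ (h.mem τ) hle]
  have : Ioc L0 (ℓ τ) = Ioc L0 (lm L0 ℓ τ) ∪ Ioc (lm L0 ℓ τ) (ℓ τ) :=
    (Ioc_union_Ioc_eq_Ioc hge hle).symm
  have e : ∫ s in Ioc L0 (ℓ τ), (C s).toReal = (∫ s in Ioc L0 (lm L0 ℓ τ), (C s).toReal) +
      ∫ s in Ioc (lm L0 ℓ τ) (ℓ τ), (C s).toReal := by
    rw [this, setIntegral_union (Ioc_disjoint_Ioc_of_le le_rfl) measurableSet_Ioc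
      ((h.cint τ).mono_set (Ioc_subset_Ioc_right hle)) hc]
  rw [e]; ring

lemma jump_le (h : CoreHyp L0 L T κ κ' E G C ℓ) {t τ : ℝ} (ht : t ∈ Ico 0 T) (hτ : τ ∈ Icc 0 t) :
    ∫ s in Ioc (lm L0 ℓ τ) (ℓ τ), ((C s).toReal - G s * κ τ) ≤ 0 := by
  have hτT : τ ∈ Icc 0 T := ⟨hτ.1, hτ.2.trans ht.2.le⟩
  have hge := h.lm_ge hτ.1
  have hsub : Ioc (lm L0 ℓ τ) (ℓ τ) ⊆ Ioc L0 (ℓ τ) := Ioc_subset_Ioc_left hge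
  refine integral_nonpos_of_ae ?_
  have h1 := ae_mono (Measure.restrict_mono hsub le_rfl) (h.ae_le τ)
  filter_upwards [h1, ae_restrict_mem measurableSet_Ioc] with s hs hm
  have hnn : 0 ≤ κ τ * G s := mul_nonneg (h.knn hτT)
    (h.Gnn s ⟨(hsub hm).1.le, hm.2.trans (h.mem τ).2⟩)
  have := ENNReal.toReal_mono ENNReal.ofReal_ne_top hs
  rw [ENNReal.toReal_ofReal hnn] at this
  simp only [Pi.zero_apply]
  linarith

lemma main (h : CoreHyp L0 L T κ κ' E G C ℓ) {t : ℝ} (ht : t ∈ Ico 0 T) (J : Set ℝ)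
    (hJ : J = {τ | τ ∈ Set.Ico 0 T ∧ lm L0 ℓ τ ≠ ℓ τ}) :
    HasSum (fun τ : (J ∩ Icc 0 t : Set ℝ) =>
      ∫ s in Ioc (lm L0 ℓ τ) (ℓ τ), ((C s).toReal - G s * κ τ))
      ((κ t * E (ℓ t) + (∫⁻ s in Ioc L0 (ℓ t), C s).toReal) -
        ∫ τ in (0:ℝ)..t, κ' τ * E (ℓ τ)) := by
  have hJc : J.Countable := hJ ▸ h.countable
  have : Countable (J ∩ Icc 0 t : Set ℝ) := (hJc.mono inter_subset_left).to_subtype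
  obtain ⟨i2, hf⟩ := h.fub ht
  have hH : IntegrableOn (fun s => (C s).toReal - G s * κ (ts ℓ t s)) (Ioc L0 (ℓ t)) :=
    (h.cint t).sub i2
  have hmemT : ∀ τ : (J ∩ Icc 0 t : Set ℝ), τ.1 ∈ Ico 0 T := fun τ =>
    ⟨τ.2.2.1, τ.2.2.2.trans_lt ht.2⟩
  have hsubU : (⋃ τ : (J ∩ Icc 0 t : Set ℝ), Ioc (lm L0 ℓ τ) (ℓ τ)) ⊆ Ioc L0 (ℓ t) := by
    refine iUnion_subset fun τ => Ioc_subset_Ioc (h.lm_ge τ.2.2.1) ?_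
    exact h.mono ⟨(hmemT τ).1, (hmemT τ).2.le⟩ ⟨ht.1, ht.2.le⟩ τ.2.2.2
  have hs := hasSum_integral_iUnion (μ := volume)
    (s := fun τ : (J ∩ Icc 0 t : Set ℝ) => Ioc (lm L0 ℓ τ) (ℓ τ))
    (f := fun s => (C s).toReal - G s * κ (ts ℓ t s)) (fun _ => measurableSet_Ioc)
    (fun a b hab => h.disj (hmemT a) (hmemT b) fun he => hab (Subtype.ext he))
    (hH.mono_set hsubU)
  have e1 : (κ t * E (ℓ t) + (∫⁻ s in Ioc L0 (ℓ t), C s).toReal) -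
        ∫ τ in (0:ℝ)..t, κ' τ * E (ℓ τ) =
      ∫ s in Ioc L0 (ℓ t), ((C s).toReal - G s * κ (ts ℓ t s)) := by
    rw [integral_sub (h.cint t) i2, h.deq (t := t) le_rfl]
    linarith
  have e2 : ∫ s in (⋃ τ : (J ∩ Icc 0 t : Set ℝ), Ioc (lm L0 ℓ τ) (ℓ τ)),
      ((C s).toReal - G s * κ (ts ℓ t s)) =
      ∫ s in Ioc L0 (ℓ t), ((C s).toReal - G s * κ (ts ℓ t s)) := by
    symm
    refine setIntegral_eq_of_subset_of_ae_sdiff_eq_zero measurableSet_Ioc.nullMeasurableSet hsubU ?_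
    have a1 : ∀ᵐ s : ℝ, s ≠ ℓ t := by simp [ae_iff]
    have a2 : ∀ᵐ s : ℝ, s ∉ ℓ '' (range ((↑) : ℚ → ℝ)) :=
      ((countable_range _).image ℓ).ae_notMem volume
    filter_upwards [a1, a2] with s hs1 hs2 hs3
    have hst : s < ℓ t := lt_of_le_of_ne hs3.1.2 hs1
    have hoff : ∀ τ ∈ Icc 0 t, s ∉ Ioc (lm L0 ℓ τ) (ℓ τ) := by
      intro τ hτ hc
      refine hs3.2 (mem_iUnion.2 ⟨⟨τ, ?_, hτ⟩, hc⟩)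
      rw [hJ]
      exact ⟨⟨hτ.1, hτ.2.trans_lt ht.2⟩, (hc.1.trans_le hc.2).ne⟩
    have hm := h.ts_mem ht.1 hs3.1.1
    rw [h.off_jump ht hs3.1.1 hst hoff hs2, ENNReal.toReal_ofReal, mul_comm, sub_self]
    exact mul_nonneg (h.knn ⟨hm.1, hm.2.trans ht.2.le⟩)
      (h.Gnn s ⟨hs3.1.1.le, hst.le.trans (h.mem t).2⟩)
  rw [e1, ← e2]
  have e3 : (fun τ : (J ∩ Icc 0 t : Set ℝ) =>
      ∫ s in Ioc (lm L0 ℓ τ) (ℓ τ), ((C s).toReal - G s * κ τ)) =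
      fun τ : (J ∩ Icc 0 t : Set ℝ) =>
      ∫ s in Ioc (lm L0 ℓ τ) (ℓ τ), ((C s).toReal - G s * κ (ts ℓ t s)) := by
    funext τ
    refine setIntegral_congr_fun measurableSet_Ioc fun s hs => ?_
    simp only [h.ts_jump ht τ.2.2 hs]
  rw [e3]
  exact hs

end CoreHyp

lemma gamma_nhds {L : ℝ} {h : ℕ → ℝ → ℝ≥0∞} {l : ℝ} (hl : l ∈ Ioc 0 L) {a : ℝ≥0∞}
    (ha : a < gammaLiminf L h l) :
    ∃ δ > 0, ∀ᶠ n in atTop, ∀ s ∈ Ioc 0 L, |s - l| < δ → a < h n s := by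
  by_contra hc
  push Not at hc
  have hc' : ∀ k : ℕ, ∃ᶠ n in atTop, ∃ s ∈ Ioc 0 L, |s - l| < 1 / ((k:ℝ) + 1) ∧ h n s ≤ a :=
    fun k => hc _ Nat.one_div_pos_of_nat
  obtain ⟨φ, hφ, hs⟩ := extraction_forall_of_frequently hc'
  choose s hs1 hs2 hs3 using hs
  set q : ℕ → ℝ := Function.extend φ s (fun _ => l) with hq
  have hqφ : ∀ k, q (φ k) = s k := fun k => hφ.injective.extend_apply _ _ _
  have hqn : ∀ n, (¬ ∃ k, φ k = n) → q n = l := fun n hn => Function.extend_apply' _ _ _ hn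
  have hq1 : ∀ n, q n ∈ Ioc 0 L := by
    intro n
    by_cases hn : ∃ k, φ k = n
    · obtain ⟨k, rfl⟩ := hn
      rw [hqφ]; exact hs1 k
    · rw [hqn n hn]; exact hl
  have hq2 : Tendsto q atTop (𝓝 l) := by
    rw [Metric.tendsto_atTop]
    intro ε hε
    obtain ⟨k0, hk0⟩ := exists_nat_one_div_lt hε
    refine ⟨φ k0, fun n hn => ?_⟩
    rw [Real.dist_eq]
    by_cases hn' : ∃ k, φ k = n
    · obtain ⟨k, rfl⟩ := hn'
      rw [hqφ]
      have hk : k0 ≤ k := hφ.le_iff_le.1 hn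
      exact ((hs2 k).trans_le (Nat.one_div_le_one_div hk)).trans hk0
    · rw [hqn n hn']; simpa using hε
  have hlim : liminf (fun n => h n (q n)) atTop ≤ a := by
    refine liminf_le_of_frequently_le' ?_
    rw [frequently_atTop]
    intro N
    exact ⟨φ N, hφ.id_le N, by rw [hqφ]; exact hs3 N⟩
  have : gammaLiminf L h l ≤ a := by
    unfold gammaLiminf
    exact iInf_le_of_le q (iInf_le_of_le hq1 (iInf_le_of_le hq2 hlim))
  exact absurd ha (not_lt.2 this)

lemma gamma_lsc {L : ℝ} {h : ℕ → ℝ → ℝ≥0∞} {l : ℝ} (hl : l ∈ Ioc 0 L) {a : ℝ≥0∞}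
    (ha : a < gammaLiminf L h l) :
    ∃ δ > 0, ∀ s ∈ Ioc 0 L, |s - l| < δ → a < gammaLiminf L h s := by
  obtain ⟨b, hab, hb⟩ := exists_between ha
  obtain ⟨δ, hδ, hn⟩ := gamma_nhds hl hb
  refine ⟨δ, hδ, fun s hs hsl => hab.trans_le ?_⟩
  refine le_iInf fun q => le_iInf fun hq1 => le_iInf fun hq2 => ?_
  refine le_liminf_of_le (by isBoundedDefault) ?_
  have : ∀ᶠ n in atTop, |q n - l| < δ :=
    ((hq2.sub_const l).abs).eventually_lt tendsto_const_nhds hsl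
  filter_upwards [hn, this] with n h1 h2
  exact (h1 _ (hq1 n) h2).le

lemma gamma_lsc_on (L : ℝ) (h : ℕ → ℝ → ℝ≥0∞) :
    LowerSemicontinuousOn (gammaLiminf L h) (Ioc 0 L) := by
  intro l hl a ha
  obtain ⟨δ, hδ, hs⟩ := gamma_lsc hl ha
  have : ∀ᶠ s in 𝓝[Ioc 0 L] l, s ∈ Metric.ball l δ :=
    mem_nhdsWithin_of_mem_nhds (Metric.ball_mem_nhds l hδ)
  filter_upwards [this, self_mem_nhdsWithin] with s h1 h2
  exact hs s h2 (by rwa [Metric.mem_ball, Real.dist_eq] at h1)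

lemma gamma_bound {L m : ℝ} (hm : 0 < m) {En : ℕ → ℝ → ℝ} {Gn : ℕ → ℝ → ℝ≥0∞} {Gcn : ℕ → ℝ → ℝ}
    (hEm : ∀ n, AntitoneOn (En n) (Set.Ioc 0 L))
    (hGc : ∀ n, ∀ l ∈ Set.Ioc (0:ℝ) L, m ≤ Gcn n l)
    {Ehom : ℝ → ℝ} 
    (hEconv : ∀ l ∈ Set.Ioc (0:ℝ) L,
      Filter.Tendsto (fun n => En n l) Filter.atTop (nhds (Ehom l)))
    (hInt : ∀ n, ∀ l₁ l₂ : ℝ, 0 < l₁ → l₁ < l₂ → l₂ < L →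
      ENNReal.ofReal (En n l₁ - En n l₂) = ∫⁻ s in Set.Ioc l₁ l₂, Gn n s)
    {l G : ℝ} (hl : l ∈ Ioo 0 L) (hG : HasDerivAt Ehom (-G) l) :
    gammaLiminf L (fun n s => Gn n s / ENNReal.ofReal (Gcn n s)) l ≤
      ENNReal.ofReal G / ENNReal.ofReal m := by
  refine le_of_forall_lt_imp_le_of_dense fun a ha => ?_
  obtain ⟨δ, hδ, hn⟩ := gamma_nhds ⟨hl.1, hl.2.le⟩ ha
  lift a to NNReal using ha.ne_top
  have hm0 : ENNReal.ofReal m ≠ 0 := by simpa using hm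
  rw [ENNReal.le_div_iff_mul_le (Or.inl hm0) (Or.inl ENNReal.ofReal_ne_top)]
  have key : ∀ x, l < x → x < L → x < l + δ → (a:ℝ) * m * (x - l) ≤ Ehom l - Ehom x := by
    intro x h1 h2 h3
    have hxm : x ∈ Ioc 0 L := ⟨hl.1.trans h1, h2.le⟩
    have hlm : l ∈ Ioc 0 L := ⟨hl.1, hl.2.le⟩
    refine ge_of_tendsto ((hEconv l hlm).sub (hEconv x hxm)) ?_
    filter_upwards [hn] with n hn
    have hnn : 0 ≤ En n l - En n x := sub_nonneg.2 (hEm n hlm hxm h1.le)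
    rw [← ENNReal.ofReal_le_ofReal_iff hnn, hInt n l x hl.1 h1 h2]
    have : ∫⁻ s in Ioc l x, ((a:ℝ≥0∞) * ENNReal.ofReal m) ≤ ∫⁻ s in Ioc l x, Gn n s := by
      refine setLIntegral_mono' measurableSet_Ioc fun s hs => ?_
      have hsm : s ∈ Ioc 0 L := ⟨hl.1.trans hs.1, hs.2.trans h2.le⟩
      have h4 := (hn s hsm (by rw [abs_lt]; constructor <;> linarith [hs.1, hs.2])).le
      have hc := hGc n s hsm
      rw [ENNReal.le_div_iff_mul_le (Or.inl (by simpa using hm.trans_le hc))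
        (Or.inl ENNReal.ofReal_ne_top)] at h4
      refine le_trans ?_ h4
      gcongr
    refine le_trans (le_of_eq ?_) this
    rw [setLIntegral_const, Real.volume_Ioc, ENNReal.ofReal_mul (by positivity),
      ENNReal.ofReal_mul (by positivity), ENNReal.ofReal_coe_nnreal]
  have hs : Tendsto (slope Ehom l) (𝓝[>] l) (𝓝 (-G)) :=
    (hasDerivAt_iff_tendsto_slope.1 hG).mono_left (nhdsWithin_mono _ fun x hx => ne_of_gt hx)
  have : -G ≤ -((a:ℝ) * m) := by
    refine le_of_tendsto hs ?_
    have hmin : l < min L (l + δ) := lt_min hl.2 (by linarith)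
    filter_upwards [Ioo_mem_nhdsGT hmin] with x hx
    have := key x hx.1 (hx.2.trans_le (min_le_left _ _)) (hx.2.trans_le (min_le_right _ _))
    have hp : 0 < x - l := sub_pos.2 hx.1
    rw [slope_def_field, div_le_iff₀ hp]
    linarith
  rw [← ENNReal.ofReal_coe_nnreal, ← ENNReal.ofReal_mul (by positivity)]
  exact ENNReal.ofReal_le_ofReal (by linarith)

/-- Energy identity for the homogenized evolution
`ℓ_hom(t) = inf{ l ∈ [L0,L] : f(t)²𝒢_hom(l) < Gc_eff(l) }`, with effective dissipated
energy `D_eff(l) = ∫_{L0}^l Gc_eff` (a Lebesgue integral of the `[0,∞]`-valued `Gc_eff`)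
and potential energy `F(t,l) = f(t)²E_hom(l) + D_eff(l)`:  for each `t ∈ [0,T)` all the
quantities are finite, the jump set is at most countable, every jump term is `≤ 0`, the
series converges absolutely and
`F(t,ℓ_hom(t)) = ∫₀ᵗ 2 f f' E_hom(ℓ_hom) dτ + Σ_{τ ∈ J ∩ [0,t]} (F(τ,ℓ_hom(τ)) − F(τ,ℓ_hom⁻(τ)))`. -/
theorem homogenized_energy_identity
    (L0 L T : ℝ) (hL0 : 0 < L0) (hL0L : L0 < L) (hT : 0 < T)
    (f : ℝ → ℝ) (hf : ContDiffOn ℝ 1 f (Set.Icc 0 T)) (hf0 : f 0 = 0)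
    (hf' : ∀ t ∈ Set.Icc (0:ℝ) T, 0 < derivWithin f (Set.Icc 0 T) t)
    (Lam : ℕ → Finset ℝ) (hLam : ∀ n, (Lam n : Set ℝ) ⊆ Set.Ioo 0 L)
    (En : ℕ → ℝ → ℝ) (hEc : ∀ n, ContinuousOn (En n) (Set.Ioc 0 L))
    (hEm : ∀ n, AntitoneOn (En n) (Set.Ioc 0 L))
    (hE1 : ∀ n, ContDiffOn ℝ 1 (En n) (Set.Ioo 0 L \ (Lam n : Set ℝ)))
    (Gn : ℕ → ℝ → ℝ≥0∞)
    (hGn : ∀ n, ∀ l ∈ Set.Ioo 0 L \ (Lam n : Set ℝ),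
      Gn n l = ENNReal.ofReal (-(deriv (En n) l)))
    (hGnL : ∀ n, Gn n L = 0)
    (hGnLam : ∀ n, ∀ l ∈ (Lam n : Set ℝ),
      Gn n l = Filter.liminf (Gn n) (nhdsWithin l (Set.Ioi l)))
    (GA GB : ℝ) (hGA : 0 < GA) (hGB : 0 < GB)
    (Gcn : ℕ → ℝ → ℝ)
    (hGcv : ∀ n, ∀ l ∈ Set.Ioc (0:ℝ) L, Gcn n l = GA ∨ Gcn n l = GB)
    (hGcrc : ∀ n, ∀ l ∈ Set.Ioo (0:ℝ) L,
      Filter.Tendsto (Gcn n) (nhdsWithin l (Set.Ioi l)) (nhds (Gcn n l)))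
    (hGcc : ∀ n, ∀ l₁ ∈ Set.Ioo 0 L \ (Lam n : Set ℝ), ∀ l₂ ∈ Set.Ioo 0 L \ (Lam n : Set ℝ),
      l₁ ≤ l₂ → (∀ s ∈ Set.Icc l₁ l₂, s ∉ (Lam n : Set ℝ)) → Gcn n l₁ = Gcn n l₂)
    (Ehom : ℝ → ℝ) (hEhc : ContinuousOn Ehom (Set.Ioc 0 L))
    (hEh1 : ContDiffOn ℝ 1 Ehom (Set.Ioo 0 L))
    (Ghom : ℝ → ℝ) (hGhom : ∀ l ∈ Set.Ioo (0:ℝ) L, Ghom l = -(deriv Ehom l))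
    (hGhomL : Ghom L = 0)
    (hEconv : ∀ l ∈ Set.Ioc (0:ℝ) L,
      Filter.Tendsto (fun n => En n l) Filter.atTop (nhds (Ehom l)))
    (hInt : ∀ n, ∀ l₁ l₂ : ℝ, 0 < l₁ → l₁ < l₂ → l₂ < L →
      ENNReal.ofReal (En n l₁ - En n l₂) = ∫⁻ s in Set.Ioc l₁ l₂, Gn n s)
    (Gceff : ℝ → ℝ≥0∞)
    (hGceff : ∀ l ∈ Set.Ioc (0:ℝ) L, Gceff l =
      if Ghom l = 0 then ⊤
      else ENNReal.ofReal (Ghom l) /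
        gammaLiminf L (fun n s => Gn n s / ENNReal.ofReal (Gcn n s)) l)
    (ℓhom : ℝ → ℝ)
    (hℓhom : ℓhom = fun t => sInf {l | l ∈ Set.Icc L0 L ∧
      ENNReal.ofReal (f t ^ 2 * Ghom l) < Gceff l})
    (Deff : ℝ → ℝ≥0∞) (hDeff : Deff = fun l => ∫⁻ s in Set.Ioc L0 l, Gceff s)
    (F : ℝ → ℝ → ℝ) (hF : F = fun t l => f t ^ 2 * Ehom l + (Deff l).toReal)
    (ℓm : ℝ → ℝ) (hℓm : ℓm = fun t => if t = 0 then L0 else sSup (ℓhom '' Set.Ico 0 t))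
    (J : Set ℝ) (hJ : J = {τ | τ ∈ Set.Ico 0 T ∧ ℓm τ ≠ ℓhom τ}) :
    J.Countable ∧
    ∀ t ∈ Set.Ico (0:ℝ) T,
      Deff (ℓhom t) ≠ ⊤ ∧
      (∀ τ ∈ J ∩ Set.Icc 0 t, F τ (ℓhom τ) - F τ (ℓm τ) ≤ 0) ∧
      Summable (fun τ : (J ∩ Set.Icc 0 t : Set ℝ) =>
        F τ.1 (ℓhom τ.1) - F τ.1 (ℓm τ.1)) ∧
      F t (ℓhom t) =
        (∫ τ in (0:ℝ)..t, 2 * f τ * derivWithin f (Set.Icc 0 T) τ * Ehom (ℓhom τ)) +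
          ∑' τ : (J ∩ Set.Icc 0 t : Set ℝ), (F τ.1 (ℓhom τ.1) - F τ.1 (ℓm τ.1)) := by
  have hm : 0 < min GA GB := lt_min hGA hGB
  have hGc : ∀ n, ∀ l ∈ Set.Ioc (0:ℝ) L, min GA GB ≤ Gcn n l := by
    intro n l hl
    rcases hGcv n l hl with h | h <;> rw [h]
    · exact min_le_left _ _
    · exact min_le_right _ _
  set g := gammaLiminf L (fun n s => Gn n s / ENNReal.ofReal (Gcn n s)) with hg
  have hder : ∀ l ∈ Ioo 0 L, HasDerivAt Ehom (-(Ghom l)) l := by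
    intro l hl
    rw [hGhom l hl, neg_neg]
    exact ((hEh1.differentiableOn one_ne_zero).differentiableAt (isOpen_Ioo.mem_nhds hl)).hasDerivAt
  have hanti : AntitoneOn Ehom (Ioc 0 L) := fun a ha b hb hab =>
    le_of_tendsto_of_tendsto' (hEconv b hb) (hEconv a ha) fun n => hEm n ha hb hab
  have hGnn : ∀ l ∈ Ioc 0 L, 0 ≤ Ghom l := by
    intro l hl
    rcases hl.2.eq_or_lt with rfl | hlt
    · exact hGhomL.ge
    have hlo : l ∈ Ioo 0 L := ⟨hl.1, hlt⟩
    have hs : Tendsto (slope Ehom l) (𝓝[>] l) (𝓝 (-(Ghom l))) :=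
      (hasDerivAt_iff_tendsto_slope.1 (hder l hlo)).mono_left
        (nhdsWithin_mono _ fun x hx => ne_of_gt hx)
    have : -(Ghom l) ≤ 0 := by
      refine le_of_tendsto hs ?_
      filter_upwards [Ioo_mem_nhdsGT hlt] with x hx
      rw [slope_def_field]
      exact div_nonpos_of_nonpos_of_nonneg
        (sub_nonpos.2 (hanti hl ⟨hl.1.trans hx.1, hx.2.le⟩ hx.1.le)) (sub_nonneg.2 hx.1.le)
    linarith
  have hgL : g L = 0 := by
    have hLm : L ∈ Ioc 0 L := ⟨hL0.trans hL0L, le_rfl⟩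
    refine le_antisymm ?_ bot_le
    rw [hg]; unfold gammaLiminf
    refine iInf_le_of_le (fun _ => L) (iInf_le_of_le (fun _ => hLm)
      (iInf_le_of_le tendsto_const_nhds ?_))
    simp [hGnL]
  have hgb : ∀ l ∈ Ioc 0 L, g l ≤ ENNReal.ofReal (Ghom l) / ENNReal.ofReal (min GA GB) := by
    intro l hl
    rcases hl.2.eq_or_lt with rfl | hlt
    · rw [hgL]; exact bot_le
    · exact gamma_bound hm hEm hGc hEconv hInt ⟨hl.1, hlt⟩ (hder l ⟨hl.1, hlt⟩)
  have hm0 : ENNReal.ofReal (min GA GB) ≠ 0 := by simpa using hm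
  have hgtop : ∀ l ∈ Ioc 0 L, g l ≠ ⊤ := fun l hl =>
    ((hgb l hl).trans_lt (ENNReal.div_lt_top ENNReal.ofReal_ne_top hm0)).ne
  have hg0 : ∀ l ∈ Ioc 0 L, Ghom l = 0 → g l = 0 := by
    intro l hl h0
    have := hgb l hl
    rw [h0] at this
    simpa using this
  have hsub : Icc L0 L ⊆ Ioc 0 L := fun x hx => ⟨hL0.trans_le hx.1, hx.2⟩
  have hCiff : ∀ c : ℝ, 0 ≤ c → ∀ l ∈ Ioc 0 L,
      (ENNReal.ofReal (c * Ghom l) ≤ Gceff l ↔ g l ≤ (ENNReal.ofReal c)⁻¹) := by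
    intro c hc l hl
    rw [hGceff l hl]
    by_cases h0 : Ghom l = 0
    · simp [h0, hg0 l hl h0]
    have hpos : 0 < Ghom l := lt_of_le_of_ne (hGnn l hl) (Ne.symm h0)
    have hp0 : ENNReal.ofReal (Ghom l) ≠ 0 := by simpa using hpos
    rw [if_neg h0, ENNReal.le_div_iff_mul_le (Or.inr hp0) (Or.inr ENNReal.ofReal_ne_top),
      ENNReal.le_inv_iff_mul_le, ENNReal.ofReal_mul hc]
    rw [show ENNReal.ofReal c * ENNReal.ofReal (Ghom l) * g l =
      (g l * ENNReal.ofReal c) * ENNReal.ofReal (Ghom l) by ring]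
    conv_lhs => rw [← one_mul (ENNReal.ofReal (Ghom l)), ← mul_assoc, mul_one]
    exact ENNReal.mul_le_mul_iff_left hp0 ENNReal.ofReal_ne_top
  have hCcl : ∀ c : ℝ, 0 ≤ c →
      IsClosed {l | l ∈ Icc L0 L ∧ ENNReal.ofReal (c * Ghom l) ≤ Gceff l} := by
    intro c hc
    refine isClosed_of_closure_subset fun l hl => ?_
    have hlI : l ∈ Icc L0 L :=
      closure_minimal (fun x hx => hx.1) isClosed_Icc hl
    refine ⟨hlI, ?_⟩
    rw [hCiff c hc l (hsub hlI)]
    by_contra hlt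
    obtain ⟨δ, hδ, hs⟩ := gamma_lsc (hsub hlI) (not_le.1 hlt)
    obtain ⟨s, hs1, hs2⟩ := Metric.mem_closure_iff.1 hl δ hδ
    have h1 := hs s (hsub hs1.1) (by rwa [dist_comm, Real.dist_eq] at hs2)
    exact absurd ((hCiff c hc s (hsub hs1.1)).1 hs1.2) (not_le.2 h1)
  have hGcont : ContinuousOn Ghom (Ioo 0 L) :=
    ((hEh1.continuousOn_deriv_of_isOpen isOpen_Ioo le_rfl).neg).congr hGhom
  have hCmeas : AEMeasurable Gceff (volume.restrict (Ioc L0 L)) := by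
    have h1 : Measurable ((Ioo 0 L).domRestrict Ghom) :=
      (continuousOn_iff_continuous_domRestrict.1 hGcont).measurable
    have h2 : Measurable ((Ioo 0 L).domRestrict g) := by
      refine LowerSemicontinuous.measurable ?_
      exact lowerSemicontinuous_restrict_iff.2
        ((gamma_lsc_on L _).mono Ioo_subset_Ioc_self)
    have h3 : AEMeasurable Gceff (volume.restrict (Ioo 0 L)) := by
      refine aemeasurable_restrict_of_measurable_subtype measurableSet_Ioo ?_
      have : (fun x : Ioo 0 L => Gceff x) = fun x : Ioo 0 L =>
          if (Ioo 0 L).domRestrict Ghom x = 0 then ⊤ else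
            ENNReal.ofReal ((Ioo 0 L).domRestrict Ghom x) / (Ioo 0 L).domRestrict g x := by
        funext x
        exact hGceff x (Ioo_subset_Ioc_self x.2)
      rw [this]
      exact Measurable.ite (h1 (measurableSet_singleton 0)) measurable_const
        (h1.ennreal_ofReal.div h2)
    rw [← restrict_Ioo_eq_restrict_Ioc]
    exact h3.mono_measure (Measure.restrict_mono (Ioo_subset_Ioo_left hL0.le) le_rfl)
  have hEI : ∀ a ∈ Icc L0 L, ∀ b ∈ Icc L0 L, ContinuousOn (fun x => -Ehom x) (Icc a b) :=
    fun a ha b hb => (hEhc.mono fun x hx => hsub ⟨ha.1.trans hx.1, hx.2.trans hb.2⟩).neg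
  have hder' : ∀ a ∈ Icc L0 L, ∀ b ∈ Icc L0 L, ∀ x ∈ Ioo a b,
      HasDerivAt (fun x => -Ehom x) (Ghom x) x := by
    intro a ha b hb x hx
    have := (hder x ⟨hL0.trans_le (ha.1.trans hx.1.le), hx.2.trans_le hb.2⟩).neg
    rw [neg_neg] at this
    exact this
  have hL0m : L0 ∈ Icc L0 L := ⟨le_rfl, hL0L.le⟩
  have hLm : L ∈ Icc L0 L := ⟨hL0L.le, le_rfl⟩
  have hGint : IntegrableOn Ghom (Ioc L0 L) :=
    intervalIntegral.integrableOn_deriv_of_nonneg (hEI _ hL0m _ hLm) (hder' _ hL0m _ hLm)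
      fun x hx => hGnn x (hsub (Ioo_subset_Icc_self hx))
  have hfd : ∀ x ∈ Icc 0 T, HasDerivWithinAt f (derivWithin f (Icc 0 T) x) (Icc 0 T) x :=
    fun x hx => ((hf.differentiableOn one_ne_zero) x hx).hasDerivWithinAt
  have hfd' : ∀ x ∈ Ioo 0 T, HasDerivAt f (derivWithin f (Icc 0 T) x) x :=
    fun x hx => (hfd x (Ioo_subset_Icc_self hx)).hasDerivAt (Icc_mem_nhds hx.1 hx.2)
  have hfc : ContinuousOn f (Icc 0 T) := hf.continuousOn
  have hf'c : ContinuousOn (derivWithin f (Icc 0 T)) (Icc 0 T) :=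
    hf.continuousOn_derivWithin (uniqueDiffOn_Icc hT) le_rfl
  have hfm : MonotoneOn f (Icc 0 T) := by
    refine monotoneOn_of_deriv_nonneg (convex_Icc 0 T) hfc ?_ ?_
    · rw [interior_Icc]
      exact fun x hx => (hfd' x hx).differentiableAt.differentiableWithinAt
    · rw [interior_Icc]
      intro x hx
      rw [(hfd' x hx).deriv]
      exact (hf' x (Ioo_subset_Icc_self hx)).le
  have h0T : (0:ℝ) ∈ Icc 0 T := ⟨le_rfl, hT.le⟩
  have hfnn : ∀ x ∈ Icc 0 T, 0 ≤ f x := fun x hx => hf0 ▸ hfm h0T hx hx.1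
  have hkc' : ContinuousOn (fun τ => 2 * f τ * derivWithin f (Icc 0 T) τ) (Icc 0 T) :=
    (continuousOn_const.mul hfc).mul hf'c
  have H : CoreHyp L0 L T (fun τ => f τ ^ 2) (fun τ => 2 * f τ * derivWithin f (Icc 0 T) τ)
      Ehom Ghom Gceff ℓhom :=
    { hL := hL0L
      hT := hT
      k0 := by simp [hf0]
      kmono := fun a ha b hb hab => pow_le_pow_left₀ (hfnn a ha) (hfm ha hb hab) 2
      kcont := hfc.pow 2
      kcont' := hkc'
      kint := by
        intro a ha
        have hs : Icc 0 a ⊆ Icc 0 T := Icc_subset_Icc_right ha.2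
        rw [intervalIntegral.integral_eq_sub_of_hasDerivAt_of_le ha.1
          (f := fun τ => f τ ^ 2) ((hfc.pow 2).mono hs)]
        · simp [hf0]
        · intro x hx
          have := (hfd' x ⟨hx.1, hx.2.trans_le ha.2⟩).pow 2
          simp only [Nat.cast_ofNat, Nat.add_one_sub_one, pow_one] at this
          exact this
        · exact (hkc'.mono (by rwa [uIcc_of_le ha.1])).intervalIntegrable
      Gnn := fun s hs => hGnn s (hsub hs)
      Gint := hGint
      Geq := by
        intro a ha b hb hab
        rw [intervalIntegral.integral_eq_sub_of_hasDerivAt_of_le hab (hEI a ha b hb)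
          (hder' a ha b hb)]
        · ring
        · rw [intervalIntegrable_iff_integrableOn_Ioc_of_le hab]
          exact hGint.mono_set (Ioc_subset_Ioc ha.1 hb.2)
      Cmeas := hCmeas
      CL := by rw [hGceff L (hsub hLm), if_pos hGhomL]
      Cpos := by
        intro l hl
        rw [hGceff l (hsub hl)]
        split_ifs with h0
        · simp
        · refine ENNReal.div_pos ?_ (hgtop l (hsub hl))
          have : 0 < Ghom l := lt_of_le_of_ne (hGnn l (hsub hl)) (Ne.symm h0)
          simpa using this
      Ccl := hCcl
      hl := fun t => by rw [hℓhom] }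
  have hlm : ℓm = CoreHyp.lm L0 ℓhom := by
    rw [hℓm]; rfl
  rw [hlm] at hJ ⊢
  clear hℓhom
  subst hF hDeff
  refine ⟨hJ ▸ H.countable, fun t ht => ?_⟩
  have hsum := H.main ht J hJ
  have hjump := fun τ (hτ : τ ∈ Icc 0 t) => H.jump ht hτ
  have hfun : (fun τ : (J ∩ Set.Icc 0 t : Set ℝ) =>
      (f τ ^ 2 * Ehom (ℓhom τ) + (∫⁻ s in Ioc L0 (ℓhom τ), Gceff s).toReal) -
      (f τ ^ 2 * Ehom (CoreHyp.lm L0 ℓhom τ) +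
        (∫⁻ s in Ioc L0 (CoreHyp.lm L0 ℓhom τ), Gceff s).toReal)) =
      fun τ : (J ∩ Icc 0 t : Set ℝ) =>
      ∫ s in Ioc (CoreHyp.lm L0 ℓhom τ) (ℓhom τ), ((Gceff s).toReal - Ghom s * f τ ^ 2) := by
    funext τ
    exact hjump τ.1 τ.2.2
  refine ⟨H.finite t, fun τ hτ => ?_, ?_, ?_⟩
  · exact (hjump τ hτ.2).trans_le (H.jump_le ht hτ.2)
  · beta_reduce
    rw [hfun]; exact hsum.summable
  · beta_reduce
    rw [hfun, hsum.tsum_eq]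
    ring
end

section
/- Let α > 0, α_hom = λα + (1−λ), S = α_hom·L, φ_n(l) = ∫₀ˡ α_n(s) ds where α_n(s) = α if the fractional part of ns/L lies in [0,λ) and α_n(s) = 1 otherwise, and φ(l) = α_hom·l. Assume there is a continuous function 𝒢̂ : (0,S) → [0,+∞) such that 𝒢_n(l) = 𝒢̂(φ_n(l))·α_n(l) for every l ∈ (0,L)∖Λ_n and every n, and 𝒢_hom(l) = α_hom·𝒢̂(φ(l)) for every l ∈ (0,L). Then for every l ∈ (0,L) with 𝒢_hom(l) ≠ 0: (Γ-liminf_n (𝒢_n/Gc_n))(l) = 𝒢̂(φ(l))·min{α/G_A, 1/G_B}, and consequently Gc_eff(l) = λ·max{G_A, α·G_B} + (1−λ)·max{G_A/α, G_B}. In particular the effective toughness is constant on { l ∈ (0,L) : 𝒢_hom(l) ≠ 0 } and depends on the elastic contrast α. -/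
open Set Filter Topology MeasureTheory
open scoped ENNReal

/-- The interfaces of the `n`-periodic laminate on `(0,L)` with volume fraction `lam`:
`Λₙ = { kL/n : k = 1,…,n−1 } ∪ { (k+lam)L/n : k = 0,…,n−1 }`. -/
def lamSet (L lam : ℝ) (n : ℕ) : Set ℝ :=
  {x | ∃ k : ℕ, 1 ≤ k ∧ k ≤ n - 1 ∧ x = k * L / n} ∪
    {x | ∃ k : ℕ, k ≤ n - 1 ∧ x = (k + lam) * L / n}

/-- The `1`-periodic elastic contrast. -/
noncomputable def perA (lam α u : ℝ) : ℝ := if Int.fract u < lam then α else 1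

lemma perA_int (lam α : ℝ) (hα : 0 < α) (a b : ℝ) :
    IntervalIntegrable (perA lam α) volume a b := by
  have hm : Measurable (perA lam α) := by
    unfold perA
    exact Measurable.ite (measurableSet_lt measurable_fract measurable_const)
      measurable_const measurable_const
  refine (intervalIntegrable_const (c := α + 1)).mono_fun hm.aestronglyMeasurable ?_
  refine Filter.Eventually.of_forall fun x => ?_
  unfold perA
  simp only [Real.norm_eq_abs]
  rw [abs_of_pos (by split_ifs <;> linarith), abs_of_pos (by linarith)]
  split_ifs <;> linarith

lemma perA_periodic (lam α : ℝ) : Function.Periodic (perA lam α) 1 := by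
  intro x
  simp [perA]

lemma perA_one (lam α : ℝ) (hα : 0 < α) (hlam : lam ∈ Set.Ioo (0:ℝ) 1) :
    ∫ u in (0:ℝ)..1, perA lam α u = lam * α + (1 - lam) := by
  rw [← intervalIntegral.integral_add_adjacent_intervals (perA_int lam α hα 0 lam)
    (perA_int lam α hα lam 1)]
  have h1 : ∫ u in (0:ℝ)..lam, perA lam α u = ∫ u in (0:ℝ)..lam, α := by
    rw [intervalIntegral.integral_of_le hlam.1.le, intervalIntegral.integral_of_le hlam.1.le,
      integral_Ioc_eq_integral_Ioo, integral_Ioc_eq_integral_Ioo]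
    refine setIntegral_congr_fun measurableSet_Ioo fun u hu => ?_
    have : Int.fract u = u := Int.fract_eq_self.2 ⟨hu.1.le, hu.2.trans hlam.2⟩
    simp [perA, this, hu.2]
  have h2 : ∫ u in lam..(1:ℝ), perA lam α u = ∫ u in lam..(1:ℝ), 1 := by
    rw [intervalIntegral.integral_of_le hlam.2.le, intervalIntegral.integral_of_le hlam.2.le,
      integral_Ioc_eq_integral_Ioo, integral_Ioc_eq_integral_Ioo]
    refine setIntegral_congr_fun measurableSet_Ioo fun u hu => ?_
    have : Int.fract u = u := Int.fract_eq_self.2 ⟨(hlam.1.trans hu.1).le, hu.2⟩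
    simp [perA, this, hu.1.le]
  rw [h1, h2]
  simp

lemma perA_bound (lam α : ℝ) (hα : 0 < α) (hlam : lam ∈ Set.Ioo (0:ℝ) 1) (x : ℝ) :
    |(∫ u in (0:ℝ)..x, perA lam α u) - (lam * α + (1 - lam)) * x| ≤
      (α + 1) + (lam * α + (1 - lam)) := by
  have h0 : 0 < lam * α + (1 - lam) := by
    have := mul_pos hlam.1 hα
    linarith [hlam.2]
  rw [← intervalIntegral.integral_add_adjacent_intervals (perA_int lam α hα 0 (⌊x⌋:ℝ))
    (perA_int lam α hα _ x)]
  have h1 : ∫ u in (0:ℝ)..(⌊x⌋:ℝ), perA lam α u = ⌊x⌋ * (lam * α + (1 - lam)) := by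
    have := (perA_periodic lam α).intervalIntegral_add_zsmul_eq ⌊x⌋ 0
      (fun t₁ t₂ => perA_int lam α hα t₁ t₂)
    simpa [perA_one lam α hα hlam, mul_add] using this
  have h2 : |∫ u in (⌊x⌋:ℝ)..x, perA lam α u| ≤ α + 1 := by
    have hx1 := Int.floor_le x
    have hx2 := Int.lt_floor_add_one x
    have := intervalIntegral.norm_integral_le_of_norm_le_const (a := (⌊x⌋:ℝ)) (b := x)
      (C := α + 1) (f := perA lam α) (by
        intro u _
        unfold perA
        rw [Real.norm_eq_abs, abs_of_pos (by split_ifs <;> linarith)]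
        split_ifs <;> linarith)
    rw [Real.norm_eq_abs, abs_of_nonneg (by linarith : (0:ℝ) ≤ x - ⌊x⌋)] at this
    nlinarith
  rw [h1]
  have hx1 := Int.floor_le x
  have hx2 := Int.lt_floor_add_one x
  rw [abs_le] at h2 ⊢
  constructor <;> nlinarith [h2.1, h2.2]

lemma fract_of_mem_lamSet {L lam : ℝ} (hL : 0 < L) (hlam : lam ∈ Set.Ioo (0:ℝ) 1) {n : ℕ}
    (hn : 1 ≤ n) {x : ℝ} (hx : x ∈ lamSet L lam n) :
    Int.fract (n * x / L) = 0 ∨ Int.fract (n * x / L) = lam := by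
  have hn' : (0:ℝ) < n := by exact_mod_cast hn
  rcases hx with ⟨k, _, _, rfl⟩ | ⟨k, _, rfl⟩
  · left
    have : (n:ℝ) * (k * L / n) / L = k := by field_simp
    rw [this]; simp
  · right
    have : (n:ℝ) * ((k + lam) * L / n) / L = k + lam := by field_simp
    rw [this, Int.fract_natCast_add]
    exact Int.fract_eq_self.2 ⟨hlam.1.le, hlam.2⟩

/-- Just to the right of any point there are no interfaces and the phase is constant. -/
lemma right_phase {L lam : ℝ} (hL : 0 < L) (hlam : lam ∈ Set.Ioo (0:ℝ) 1) {n : ℕ}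
    (hn : 1 ≤ n) (y : ℝ) :
    ∀ᶠ s in 𝓝[>] y, s ∉ lamSet L lam n ∧
      (Int.fract (n * s / L) < lam ↔ Int.fract (n * y / L) < lam) := by
  have hn' : (0:ℝ) < n := by exact_mod_cast hn
  have key : ∀ q : ℝ, q ≤ 1 → Int.fract (n * y / L) < q →
      ∀ᶠ s in 𝓝[>] y, Int.fract (n * y / L) < Int.fract (n * s / L) ∧
        Int.fract (n * s / L) < q := by
    intro q hq1 hq
    have hd : y < y + (q - Int.fract (n * y / L)) * L / n := by
      have : 0 < (q - Int.fract (n * y / L)) * L / n := by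
        have := sub_pos.2 hq
        positivity
      linarith
    filter_upwards [Ioo_mem_nhdsGT hd] with s hs
    have e : (n:ℝ) * s / L = n * y / L + n * (s - y) / L := by ring
    have h1 : 0 < n * (s - y) / L := by
      have := sub_pos.2 hs.1
      positivity
    have h2 : n * (s - y) / L < q - Int.fract (n * y / L) := by
      rw [div_lt_iff₀ hL]
      have : s - y < (q - Int.fract (n * y / L)) * L / n := by linarith [hs.2]
      rw [lt_div_iff₀ hn'] at this
      linarith
    have h3 : Int.fract (n * s / L) = Int.fract (n * y / L) + n * (s - y) / L := by
      rw [Int.fract_eq_iff]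
      refine ⟨by linarith [Int.fract_nonneg (n * y / L)], by linarith, ⌊n * y / L⌋, ?_⟩
      rw [e]
      have := Int.self_sub_floor (n * y / L)
      linarith
    rw [h3]
    constructor <;> linarith
  have hnn := Int.fract_nonneg (n * y / L)
  by_cases h : Int.fract (n * y / L) < lam
  · filter_upwards [key lam hlam.2.le h] with s hs
    refine ⟨fun hm => ?_, by simp [h, hs.2]⟩
    rcases fract_of_mem_lamSet hL hlam hn hm with h' | h' <;> linarith [hs.1, hs.2]
  · filter_upwards [key 1 le_rfl (Int.fract_lt_one _)] with s hs
    push Not at h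
    refine ⟨fun hm => ?_, ?_⟩
    · rcases fract_of_mem_lamSet hL hlam hn hm with h' | h' <;> linarith [hs.1, hs.2, hlam.1]
    · constructor <;> intro h' <;> linarith [hs.1]

lemma phin_tendsto {L lam α αhom : ℝ} (hL : 0 < L) (hlam : lam ∈ Set.Ioo (0:ℝ) 1) (hα : 0 < α)
    (hαhom : αhom = lam * α + (1 - lam))
    (αn : ℕ → ℝ → ℝ)
    (hαn : ∀ n : ℕ, 1 ≤ n → ∀ s : ℝ,
      αn n s = if Int.fract (n * s / L) < lam then α else 1)
    (φn : ℕ → ℝ → ℝ) (hφn : ∀ n : ℕ, 1 ≤ n → ∀ l : ℝ, φn n l = ∫ s in (0:ℝ)..l, αn n s)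
    (l : ℝ) :
    Tendsto (fun p : ℕ × ℝ => φn p.1 p.2) (atTop ×ˢ 𝓝 l) (𝓝 (αhom * l)) := by
  have hb : ∀ n : ℕ, 1 ≤ n → ∀ s, |φn n s - αhom * s| ≤ (L * ((α + 1) + αhom)) / n := by
    intro n hn s
    have hn' : (0:ℝ) < n := by exact_mod_cast hn
    have hc : (n / L : ℝ) ≠ 0 := by positivity
    have e1 : φn n s = (L / n) * ∫ u in (0:ℝ)..(n / L * s), perA lam α u := by
      rw [hφn n hn]
      have := intervalIntegral.integral_comp_mul_left (a := 0) (b := s) (perA lam α) hc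
      simp only [mul_zero, smul_eq_mul, inv_div] at this
      rw [← this]
      congr 1
      ext u
      rw [hαn n hn, perA, div_mul_eq_mul_div]
    have := perA_bound lam α hα hlam (n / L * s)
    rw [← hαhom] at this
    have e2 : φn n s - αhom * s = (L / n) *
        ((∫ u in (0:ℝ)..(n / L * s), perA lam α u) - αhom * (n / L * s)) := by
      rw [e1]; field_simp
    rw [e2, abs_mul, abs_of_pos (by positivity), mul_comm L, mul_div_assoc, mul_comm _ (L / n : ℝ)]
    gcongr
  have h1 : Tendsto (fun p : ℕ × ℝ => φn p.1 p.2 - αhom * p.2) (atTop ×ˢ 𝓝 l) (𝓝 0) := by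
    have h2 : Tendsto (fun p : ℕ × ℝ => (L * ((α + 1) + αhom)) / (p.1 : ℝ)) (atTop ×ˢ 𝓝 l) (𝓝 0) :=
      (tendsto_const_div_atTop_nhds_zero_nat _).comp tendsto_fst
    refine squeeze_zero_norm' ?_ h2
    filter_upwards [tendsto_fst.eventually (eventually_ge_atTop 1)] with p hp
    exact hb p.1 hp p.2
  have h3 : Tendsto (fun p : ℕ × ℝ => αhom * p.2) (atTop ×ˢ 𝓝 l) (𝓝 (αhom * l)) :=
    tendsto_snd.const_mul _
  simpa using h1.add h3

/-- Explicit computation of the effective toughness for the laminate: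
under the change-of-variable structure `𝒢ₙ(l) = 𝒢̂(φₙ(l))·αₙ(l)` and
`𝒢_hom(l) = α_hom·𝒢̂(φ(l))`, at every `l` with `𝒢_hom(l) ≠ 0` one has
`(Γ-liminf (𝒢ₙ/Gcₙ))(l) = 𝒢̂(φ(l))·min{α/G_A, 1/G_B}` and hence
`Gc_eff(l) = λ·max{G_A, α G_B} + (1−λ)·max{G_A/α, G_B}`; in particular the effective
toughness is constant there and depends on the elastic contrast `α`. -/
theorem effective_toughness_explicit
    (L0 L T : ℝ) (hL0 : 0 < L0) (hL0L : L0 < L) (hT : 0 < T)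
    (f : ℝ → ℝ) (hf : ContDiffOn ℝ 1 f (Set.Icc 0 T)) (hf0 : f 0 = 0)
    (hf' : ∀ t ∈ Set.Icc (0:ℝ) T, 0 < derivWithin f (Set.Icc 0 T) t)
    (GA GB : ℝ) (hGA : 0 < GA) (hGB : 0 < GB)
    (lam : ℝ) (hlam : lam ∈ Set.Ioo (0:ℝ) 1)
    (Gcn : ℕ → ℝ → ℝ)
    (hGcn : ∀ n : ℕ, 1 ≤ n → ∀ l : ℝ,
      Gcn n l = if Int.fract (n * l / L) < lam then GA else GB)
    (En : ℕ → ℝ → ℝ) (hEc : ∀ n : ℕ, 1 ≤ n → ContinuousOn (En n) (Set.Ioc 0 L))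
    (hEm : ∀ n : ℕ, 1 ≤ n → AntitoneOn (En n) (Set.Ioc 0 L))
    (hE1 : ∀ n : ℕ, 1 ≤ n → ContDiffOn ℝ 1 (En n) (Set.Ioo 0 L \ lamSet L lam n))
    (Gn : ℕ → ℝ → ℝ≥0∞)
    (hGn : ∀ n : ℕ, 1 ≤ n → ∀ l ∈ Set.Ioo 0 L \ lamSet L lam n,
      Gn n l = ENNReal.ofReal (-(deriv (En n) l)))
    (hGnL : ∀ n : ℕ, 1 ≤ n → Gn n L = 0)
    (hGnLam : ∀ n : ℕ, 1 ≤ n → ∀ l ∈ lamSet L lam n,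
      Gn n l = Filter.liminf (Gn n) (nhdsWithin l (Set.Ioi l)))
    (Ehom : ℝ → ℝ) (hEhc : ContinuousOn Ehom (Set.Ioc 0 L))
    (hEh1 : ContDiffOn ℝ 1 Ehom (Set.Ioo 0 L))
    (Ghom : ℝ → ℝ) (hGhom : ∀ l ∈ Set.Ioo (0:ℝ) L, Ghom l = -(deriv Ehom l))
    (hGhomL : Ghom L = 0)
    (hEconv : ∀ l ∈ Set.Ioc (0:ℝ) L,
      Filter.Tendsto (fun n => En n l) Filter.atTop (nhds (Ehom l)))
    (hInt : ∀ n : ℕ, 1 ≤ n → ∀ l₁ l₂ : ℝ, 0 < l₁ → l₁ < l₂ → l₂ < L →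
      ENNReal.ofReal (En n l₁ - En n l₂) = ∫⁻ s in Set.Ioc l₁ l₂, Gn n s)
    (Gceff : ℝ → ℝ≥0∞)
    (hGceff : ∀ l ∈ Set.Ioc (0:ℝ) L, Gceff l =
      if Ghom l = 0 then ⊤
      else ENNReal.ofReal (Ghom l) /
        gammaLiminf L (fun n s => Gn n s / ENNReal.ofReal (Gcn n s)) l)
    (α : ℝ) (hα : 0 < α)
    (αhom : ℝ) (hαhom : αhom = lam * α + (1 - lam))
    (S : ℝ) (hS : S = αhom * L)
    (αn : ℕ → ℝ → ℝ)
    (hαn : ∀ n : ℕ, 1 ≤ n → ∀ s : ℝ,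
      αn n s = if Int.fract (n * s / L) < lam then α else 1)
    (φn : ℕ → ℝ → ℝ) (hφn : ∀ n : ℕ, 1 ≤ n → ∀ l : ℝ, φn n l = ∫ s in (0:ℝ)..l, αn n s)
    (φ : ℝ → ℝ) (hφ : φ = fun l => αhom * l)
    (Ghat : ℝ → ℝ) (hGhatc : ContinuousOn Ghat (Set.Ioo 0 S))
    (hGhatnn : ∀ s ∈ Set.Ioo (0:ℝ) S, 0 ≤ Ghat s)
    (hrep : ∀ n : ℕ, 1 ≤ n → ∀ l ∈ Set.Ioo 0 L \ lamSet L lam n,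
      Gn n l = ENNReal.ofReal (Ghat (φn n l) * αn n l))
    (hrephom : ∀ l ∈ Set.Ioo (0:ℝ) L, Ghom l = αhom * Ghat (φ l)) :
    ∀ l ∈ Set.Ioo (0:ℝ) L, Ghom l ≠ 0 →
      gammaLiminf L (fun n s => Gn n s / ENNReal.ofReal (Gcn n s)) l =
        ENNReal.ofReal (Ghat (φ l) * min (α / GA) (1 / GB)) ∧
      Gceff l = ENNReal.ofReal (lam * max GA (α * GB) + (1 - lam) * max (GA / α) GB) := by
  intro l hl hne
  have hL : 0 < L := hL0.trans hL0L
  have hαh : 0 < αhom := by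
    rw [hαhom]
    have := mul_pos hlam.1 hα
    linarith [hlam.2]
  have hφl : φ l = αhom * l := by rw [hφ]
  have hφmem : αhom * l ∈ Set.Ioo 0 S := by
    rw [hS]
    exact ⟨mul_pos hαh hl.1, mul_lt_mul_of_pos_left hl.2 hαh⟩
  have hg : 0 < Ghat (φ l) := by
    have h0 : 0 ≤ Ghat (φ l) := hGhatnn _ (hφl ▸ hφmem)
    refine lt_of_le_of_ne h0 fun h => hne ?_
    rw [hrephom l hl, ← h, mul_zero]
  have hG : Tendsto (fun p : ℕ × ℝ => Ghat (φn p.1 p.2)) (atTop ×ˢ 𝓝 l) (𝓝 (Ghat (φ l))) := by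
    rw [hφl]
    exact ((hGhatc.continuousAt (isOpen_Ioo.mem_nhds hφmem)).tendsto).comp
      (phin_tendsto hL hlam hα hαhom αn hαn φn hφn l)
  set m := min (α / GA) (1 / GB) with hm
  have hmpos : 0 < m := lt_min (by positivity) (by positivity)
  have hratio : ∀ n : ℕ, 1 ≤ n → ∀ s, m ≤ αn n s / Gcn n s ∧ 0 < αn n s ∧ 0 < Gcn n s := by
    intro n hn s
    rw [hαn n hn, hGcn n hn]
    split_ifs
    · exact ⟨min_le_left _ _, hα, hGA⟩
    · exact ⟨min_le_right _ _, one_pos, hGB⟩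
  have hlow : ENNReal.ofReal (Ghat (φ l) * m) ≤
      gammaLiminf L (fun n s => Gn n s / ENNReal.ofReal (Gcn n s)) l := by
    unfold gammaLiminf
    refine le_iInf fun seq => le_iInf fun hseq => le_iInf fun hlim => ?_
    refine le_of_forall_lt fun b hb => ?_
    -- pick a real constant
    have hcont : Tendsto (fun c : ℝ => ENNReal.ofReal (c * m)) (𝓝[<] (Ghat (φ l)))
        (𝓝 (ENNReal.ofReal (Ghat (φ l) * m))) := by
      have : Continuous fun c : ℝ => ENNReal.ofReal (c * m) :=
        ENNReal.continuous_ofReal.comp (continuous_id.mul continuous_const)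
      exact this.continuousAt.tendsto.mono_left nhdsWithin_le_nhds
    obtain ⟨c, hbc, hc, hc0⟩ := ((hcont.eventually (lt_mem_nhds hb)).and
      (Filter.Eventually.and self_mem_nhdsWithin
        (nhdsWithin_le_nhds (lt_mem_nhds hg)))).exists
    refine hbc.trans_le ?_
    have hev := hG.eventually (lt_mem_nhds hc)
    have hev2 : ∀ᶠ p : ℕ × ℝ in atTop ×ˢ 𝓝 l, p.2 ∈ Set.Ioo 0 L :=
      tendsto_snd.eventually (isOpen_Ioo.mem_nhds hl)
    obtain ⟨P, hP, Q, hQ, hPQ⟩ := Filter.eventually_prod_iff.1 (hev.and hev2)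
    refine le_liminf_of_le (by isBoundedDefault) ?_
    filter_upwards [hP, hlim.eventually hQ.eventually_nhds, eventually_ge_atTop 1] with n hnP hnQ hn
    have hbase : ENNReal.ofReal (c * αn n (seq n)) ≤ Gn n (seq n) := by
      by_cases hmem : seq n ∈ lamSet L lam n
      · rw [hGnLam n hn _ hmem]
        refine le_liminf_of_le (by isBoundedDefault) ?_
        filter_upwards [right_phase hL hlam hn (seq n), nhdsWithin_le_nhds hnQ] with s hs hsQ
        obtain ⟨h1, h2⟩ := hPQ hnP hsQ
        rw [hrep n hn s ⟨h2, hs.1⟩]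
        have : αn n (seq n) = αn n s := by
          rw [hαn n hn, hαn n hn]
          simp only [hs.2]
        rw [this]
        exact ENNReal.ofReal_le_ofReal (mul_le_mul_of_nonneg_right h1.le (hratio n hn s).2.1.le)
      · obtain ⟨h1, h2⟩ := hPQ hnP hnQ.self_of_nhds
        rw [hrep n hn _ ⟨h2, hmem⟩]
        exact ENNReal.ofReal_le_ofReal (mul_le_mul_of_nonneg_right h1.le (hratio n hn _).2.1.le)
    obtain ⟨r1, r2, r3⟩ := hratio n hn (seq n)
    calc ENNReal.ofReal (c * m) ≤ ENNReal.ofReal (c * αn n (seq n) / Gcn n (seq n)) := by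
          refine ENNReal.ofReal_le_ofReal ?_
          rw [mul_div_assoc]
          exact mul_le_mul_of_nonneg_left r1 hc0.le
      _ = ENNReal.ofReal (c * αn n (seq n)) / ENNReal.ofReal (Gcn n (seq n)) :=
          ENNReal.ofReal_div_of_pos r3
      _ ≤ _ := ENNReal.div_le_div_right hbase _
  have hup : ∀ θ : ℝ, 0 < θ → θ < 1 → θ ≠ lam → ∀ r : ℝ,
      r = (if θ < lam then α else 1) / (if θ < lam then GA else GB) →
      gammaLiminf L (fun n s => Gn n s / ENNReal.ofReal (Gcn n s)) l ≤
        ENNReal.ofReal (Ghat (φ l) * r) := by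
    intro θ h0 h1 hθ r hr
    let x : ℕ → ℝ := fun n => (⌊n * l / L⌋ + θ) * L / n
    have hx : Tendsto x atTop (𝓝 l) := by
      have h2 : Tendsto (fun n : ℕ => l + -(L / n)) atTop (𝓝 (l + -0)) :=
        (tendsto_const_div_atTop_nhds_zero_nat L).neg.const_add l
      have h3 : Tendsto (fun n : ℕ => l + L / n) atTop (𝓝 (l + 0)) :=
        (tendsto_const_div_atTop_nhds_zero_nat L).const_add l
      simp only [neg_zero, add_zero] at h2 h3
      refine tendsto_of_tendsto_of_tendsto_of_le_of_le' h2 h3 ?_ ?_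
      · filter_upwards [eventually_ge_atTop 1] with n hn
        have hn' : (0:ℝ) < n := by exact_mod_cast hn
        have hf := Int.lt_floor_add_one (n * l / L)
        have e : l + -(L / n) = (n * l / L - 1) * L / n := by field_simp; ring
        rw [e]
        show _ ≤ (⌊n * l / L⌋ + θ) * L / n
        gcongr
        linarith
      · filter_upwards [eventually_ge_atTop 1] with n hn
        have hn' : (0:ℝ) < n := by exact_mod_cast hn
        have hf := Int.floor_le (n * l / L)
        have e : l + L / n = (n * l / L + 1) * L / n := by field_simp
        rw [e]
        show (⌊n * l / L⌋ + θ) * L / n ≤ _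
        gcongr
    classical
    let y : ℕ → ℝ := fun n => if x n ∈ Set.Ioo 0 L then x n else L
    have hev : ∀ᶠ n in atTop, x n ∈ Set.Ioo 0 L := hx.eventually (isOpen_Ioo.mem_nhds hl)
    have hyx : ∀ᶠ n in atTop, x n = y n := by
      filter_upwards [hev] with n hn
      simp only [y]; rw [if_pos hn]
    have hymem : ∀ n, y n ∈ Set.Ioc 0 L := by
      intro n
      simp only [y]
      split_ifs with h
      · exact ⟨h.1, h.2.le⟩
      · exact ⟨hL, le_rfl⟩
    have hy : Tendsto y atTop (𝓝 l) := hx.congr' hyx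
    have hGx : Tendsto (fun n => Ghat (φn n (x n))) atTop (𝓝 (Ghat (φ l))) :=
      hG.comp (tendsto_id.prodMk hx)
    have hlim : Tendsto (fun n => Gn n (y n) / ENNReal.ofReal (Gcn n (y n))) atTop
        (𝓝 (ENNReal.ofReal (Ghat (φ l) * r))) := by
      refine ((ENNReal.continuous_ofReal.tendsto _).comp (hGx.mul_const r)).congr' ?_
      filter_upwards [hev, hyx, eventually_ge_atTop 1] with n hn hxy hn1
      have hn' : (0:ℝ) < n := by exact_mod_cast hn1
      have hfr : Int.fract (n * x n / L) = θ := by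
        have : (n:ℝ) * x n / L = ⌊n * l / L⌋ + θ := by
          simp only [x]; field_simp
        rw [this, Int.fract_intCast_add]
        exact Int.fract_eq_self.2 ⟨h0.le, h1⟩
      have hnot : x n ∉ lamSet L lam n := by
        intro hmem
        rcases fract_of_mem_lamSet hL hlam hn1 hmem with h | h <;> rw [hfr] at h
        · exact h0.ne' h
        · exact hθ h
      rw [← hxy, hrep n hn1 _ ⟨hn, hnot⟩, ← ENNReal.ofReal_div_of_pos (hratio n hn1 _).2.2]
      simp only [Function.comp]
      rw [mul_div_assoc, hαn n hn1, hGcn n hn1, hfr, hr]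
    unfold gammaLiminf
    refine (iInf_le_of_le y (iInf_le_of_le hymem (iInf_le_of_le hy ?_)))
    exact hlim.liminf_eq.le
  have hgam : gammaLiminf L (fun n s => Gn n s / ENNReal.ofReal (Gcn n s)) l =
      ENNReal.ofReal (Ghat (φ l) * m) := by
    refine le_antisymm ?_ hlow
    rcases min_choice (α / GA) (1 / GB) with h | h
    · rw [hm, h]
      have : lam / 2 < lam := by linarith [hlam.1]
      exact hup (lam / 2) (by linarith [hlam.1]) (by linarith [hlam.2]) this.ne _ (by simp [this])
    · rw [hm, h]
      have : lam < (1 + lam) / 2 := by linarith [hlam.2]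
      exact hup ((1 + lam) / 2) (by linarith [hlam.1]) (by linarith [hlam.2]) this.ne' _
        (by simp [not_lt.2 this.le])
  refine ⟨hgam, ?_⟩
  rw [hGceff l ⟨hl.1, hl.2.le⟩, if_neg hne, hgam, ← ENNReal.ofReal_div_of_pos (mul_pos hg hmpos),
    hrephom l hl]
  congr 1
  rw [div_eq_iff (mul_pos hg hmpos).ne', hm, hαhom]
  rcases le_total (α / GA) (1 / GB) with h | h
  · have h' : α * GB ≤ GA := by rwa [div_le_div_iff₀ hGA hGB, one_mul] at h
    have h2 : GB ≤ GA / α := by rw [le_div_iff₀ hα]; linarith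
    rw [min_eq_left h, max_eq_left h', max_eq_left h2]
    field_simp
  · have h' : GA ≤ α * GB := by rwa [div_le_div_iff₀ hGB hGA, one_mul] at h
    have h2 : GA / α ≤ GB := by rw [div_le_iff₀ hα]; linarith
    rw [min_eq_right h, max_eq_right h', max_eq_right h2]
    field_simp
end

section
/- Set S = max{ |f(t)| : t ∈ [0,T] }, f̄(t) = max{ |f(τ)| : τ ∈ [0,t] }, and define ℓ̂(s) = inf{ l ∈ [L0,L] : s²·𝒢(l) < Gc(l) } for s ∈ [0,S], and ℓ = ℓ̂ ∘ f̄ : [0,T) → [L0,L]. Then ℓ is non-decreasing, right-continuous, ℓ(0) = L0, and ℓ satisfies Griffith's criterion for the non-monotone load: (i) f(t)²·𝒢(ℓ(t)) ≤ Gc(ℓ(t)) for every t ∈ [0,T); (ii) whenever f(t)²·𝒢(ℓ(t)) < Gc(ℓ(t)), the right derivative of ℓ at t exists and equals 0; (iii) at every jump point t of ℓ one has f(t)²·𝒢(l) ≥ Gc(l) for every l ∈ [ℓ⁻(t), ℓ(t)), where ℓ⁻(t) is the left limit of ℓ at t (with ℓ⁻(0) := L0). -/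
open Set Filter Topology MeasureTheory
open scoped ENNReal

/-- Griffith's criterion for a non-decreasing, right-continuous evolution
`ℓ : [0,T) → [L0,L]` with `ℓ(0) = L0`, with energy release `G(t,l) = f(t)²·Gr(l)` and
toughness `Gc`:  (i) `G(t,ℓ(t)) ≤ Gc(ℓ(t))`;  (ii) if `G(t,ℓ(t)) < Gc(ℓ(t))` then the
right derivative of `ℓ` at `t` exists and equals `0`;  (iii) at every jump point `t`
one has `G(t,l) ≥ Gc(l)` for all `l ∈ [ℓ⁻(t), ℓ(t))`, where the left limit `ℓ⁻(t)` of the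
monotone function `ℓ` is `sSup (ℓ '' [0,t))` (and `ℓ⁻(0) := L0`). -/
def GriffithCriterion (L0 L T : ℝ) (f : ℝ → ℝ) (Gr : ℝ → ℝ≥0∞) (Gc : ℝ → ℝ)
    (ℓ : ℝ → ℝ) : Prop :=
  MonotoneOn ℓ (Set.Ico 0 T) ∧
  (∀ t ∈ Set.Ico (0:ℝ) T, Filter.Tendsto ℓ (nhdsWithin t (Set.Ioo t T)) (nhds (ℓ t))) ∧
  ℓ 0 = L0 ∧
  (∀ t ∈ Set.Ico (0:ℝ) T, ℓ t ∈ Set.Icc L0 L) ∧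
  (∀ t ∈ Set.Ico (0:ℝ) T,
      ENNReal.ofReal (f t ^ 2) * Gr (ℓ t) ≤ ENNReal.ofReal (Gc (ℓ t))) ∧
  (∀ t ∈ Set.Ico (0:ℝ) T,
      ENNReal.ofReal (f t ^ 2) * Gr (ℓ t) < ENNReal.ofReal (Gc (ℓ t)) →
      HasDerivWithinAt ℓ 0 (Set.Ico t T) t) ∧
  (∀ t ∈ Set.Ico (0:ℝ) T,
      (if t = 0 then L0 else sSup (ℓ '' Set.Ico 0 t)) ≠ ℓ t →
      ∀ l, (if t = 0 then L0 else sSup (ℓ '' Set.Ico 0 t)) ≤ l → l < ℓ t →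
        ENNReal.ofReal (Gc l) ≤ ENNReal.ofReal (f t ^ 2) * Gr l)


theorem griffith_finite_decrease (F : Finset ℝ) : ∀ (g : ℝ → ℝ) (a b : ℝ), a ≤ b →
    ContinuousOn g (Set.Icc a b) →
    (∀ x ∈ Set.Ioo a b, x ∉ F → DifferentiableAt ℝ g x ∧ deriv g x ≤ 0) → g b ≤ g a := by
  induction F using Finset.induction_on with
  | empty =>
    intro g a b hab hc hd
    have := antitoneOn_of_deriv_nonpos (convex_Icc a b) hc
      (by
        rw [interior_Icc]
        intro x hx
        exact (hd x hx (by simp)).1.differentiableWithinAt)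
      (by
        rw [interior_Icc]
        intro x hx
        exact (hd x hx (by simp)).2)
    exact this (left_mem_Icc.2 hab) (right_mem_Icc.2 hab) hab
  | insert p F hp ih =>
    intro g a b hab hc hd
    by_cases hpm : p ∈ Set.Ioo a b
    · have h1 : g p ≤ g a := by
        apply ih g a p hpm.1.le (hc.mono (Icc_subset_Icc_right hpm.2.le))
        intro x hx hxF
        apply hd x ⟨hx.1, hx.2.trans hpm.2⟩
        simp only [Finset.mem_insert, not_or]
        exact ⟨hx.2.ne, hxF⟩
      have h2 : g b ≤ g p := by
        apply ih g p b hpm.2.le (hc.mono (Icc_subset_Icc_left hpm.1.le))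
        intro x hx hxF
        apply hd x ⟨hpm.1.trans hx.1, hx.2⟩
        simp only [Finset.mem_insert, not_or]
        exact ⟨hx.1.ne', hxF⟩
      exact h2.trans h1
    · apply ih g a b hab hc
      intro x hx hxF
      apply hd x hx
      simp only [Finset.mem_insert, not_or]
      refine ⟨?_, hxF⟩
      rintro rfl
      exact hpm hx

/-- Non-monotone loading: with `f̄(t) = max{|f(τ)| : τ ∈ [0,t]}` and
`ℓ̂(s) = inf{ l ∈ [L0,L] : s²𝒢(l) < Gc(l) }`, the function `ℓ = ℓ̂ ∘ f̄` is non-decreasing,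
right-continuous, starts at `L0`, and satisfies Griffith's criterion for the load `f`. -/
theorem griffith_nonmonotone_load
    (L0 L T : ℝ) (hL0 : 0 < L0) (hL0L : L0 < L) (hT : 0 < T)
    (f : ℝ → ℝ) (hf : ContDiffOn ℝ 1 f (Set.Icc 0 T)) (hf0 : f 0 = 0)
    (Lam : Finset ℝ) (hLam : (Lam : Set ℝ) ⊆ Set.Ioo 0 L)
    (E : ℝ → ℝ) (hEc : ContinuousOn E (Set.Ioc 0 L)) (hEm : AntitoneOn E (Set.Ioc 0 L))
    (hE1 : ContDiffOn ℝ 1 E (Set.Ioo 0 L \ (Lam : Set ℝ)))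
    (Gr : ℝ → ℝ≥0∞)
    (hGr : ∀ l ∈ Set.Ioo 0 L \ (Lam : Set ℝ), Gr l = ENNReal.ofReal (-(deriv E l)))
    (hGrL : Gr L = 0)
    (hGrLam : ∀ l ∈ (Lam : Set ℝ), Gr l = Filter.liminf Gr (nhdsWithin l (Set.Ioi l)))
    (GA GB : ℝ) (hGA : 0 < GA) (hGB : 0 < GB)
    (Gc : ℝ → ℝ) (hGcv : ∀ l ∈ Set.Ioc (0:ℝ) L, Gc l = GA ∨ Gc l = GB)
    (hGcrc : ∀ l ∈ Set.Ioo (0:ℝ) L,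
      Filter.Tendsto Gc (nhdsWithin l (Set.Ioi l)) (nhds (Gc l)))
    (hGcc : ∀ l₁ ∈ Set.Ioo 0 L \ (Lam : Set ℝ), ∀ l₂ ∈ Set.Ioo 0 L \ (Lam : Set ℝ),
      l₁ ≤ l₂ → (∀ s ∈ Set.Icc l₁ l₂, s ∉ (Lam : Set ℝ)) → Gc l₁ = Gc l₂)
    (S : ℝ) (hS : S = sSup ((fun t => |f t|) '' Set.Icc 0 T))
    (fbar : ℝ → ℝ) (hfbar : fbar = fun t => sSup ((fun τ => |f τ|) '' Set.Icc 0 t))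
    (ℓhat : ℝ → ℝ)
    (hℓhat : ℓhat = fun s => sInf {l | l ∈ Set.Icc L0 L ∧
      ENNReal.ofReal (s ^ 2) * Gr l < ENNReal.ofReal (Gc l)})
    (ℓ : ℝ → ℝ) (hℓ : ℓ = fun t => ℓhat (fbar t)) :
    GriffithCriterion L0 L T f Gr Gc ℓ := by
  classical
  have _ := hS
  -- Lipschitz bound for the load
  obtain ⟨K, hK⟩ : ∃ K : ℝ, 0 ≤ K ∧
      ∀ x ∈ Set.Icc 0 T, ∀ y ∈ Set.Icc 0 T, |f x - f y| ≤ K * |x - y| := by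
    obtain ⟨K, hK⟩ := hf.exists_lipschitzOnWith one_ne_zero (convex_Icc 0 T) isCompact_Icc
    refine ⟨K, K.2, fun x hx y hy => ?_⟩
    have := hK.dist_le_mul x hx y hy
    simpa [Real.dist_eq] using this
  obtain ⟨hK0, hK⟩ := hK
  -- basic facts on `fbar`
  have hbdd : ∀ t, t ≤ T → BddAbove ((fun τ => |f τ|) '' Set.Icc 0 t) := by
    intro t ht
    refine ⟨K * T, ?_⟩
    rintro _ ⟨τ, hτ, rfl⟩
    have h := hK τ ⟨hτ.1, hτ.2.trans ht⟩ 0 ⟨le_rfl, hT.le⟩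
    rw [hf0, sub_zero, sub_zero, abs_of_nonneg hτ.1] at h
    exact h.trans (mul_le_mul_of_nonneg_left (hτ.2.trans ht) hK0)
  have hle : ∀ t, t ≤ T → ∀ τ ∈ Set.Icc 0 t, |f τ| ≤ fbar t := by
    intro t ht τ hτ
    rw [hfbar]
    exact le_csSup (hbdd t ht) ⟨τ, hτ, rfl⟩
  have hlub : ∀ t, 0 ≤ t → ∀ b, (∀ τ ∈ Set.Icc 0 t, |f τ| ≤ b) → fbar t ≤ b := by
    intro t ht b hb
    rw [hfbar]
    apply csSup_le
    · exact ⟨_, 0, ⟨le_rfl, ht⟩, rfl⟩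
    · rintro _ ⟨τ, hτ, rfl⟩
      exact hb τ hτ
  have hfb0 : ∀ t, 0 ≤ t → t ≤ T → 0 ≤ fbar t := fun t h0 ht =>
    (abs_nonneg _).trans (hle t ht 0 ⟨le_rfl, h0⟩)
  have hfbmono : ∀ t t', 0 ≤ t → t ≤ t' → t' ≤ T → fbar t ≤ fbar t' := fun t t' h0 h1 h2 =>
    hlub t h0 _ (fun τ hτ => hle t' h2 τ ⟨hτ.1, hτ.2.trans h1⟩)
  have hstep : ∀ t t', 0 ≤ t → t ≤ t' → t' ≤ T → ∀ x ∈ Set.Icc t t',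
      fbar t' ≤ max (fbar t) (|f x| + K * (t' - t)) := by
    intro t t' h0 h1 h2 x hx
    refine hlub t' (h0.trans h1) _ (fun τ hτ => ?_)
    rcases le_total τ t with h | h
    · exact (hle t (h1.trans h2) τ ⟨hτ.1, h⟩).trans (le_max_left _ _)
    · refine le_trans ?_ (le_max_right _ _)
      have h3 := hK τ ⟨hτ.1, hτ.2.trans h2⟩ x ⟨h0.trans hx.1, hx.2.trans h2⟩
      have h4 : |τ - x| ≤ t' - t := by
        rw [abs_le]; constructor <;> linarith [hx.1, hx.2, hτ.2]
      have h5 := mul_le_mul_of_nonneg_left h4 hK0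
      have h6 := abs_sub_abs_le_abs_sub (f τ) (f x)
      linarith
  have hfblip : ∀ t t', 0 ≤ t → t ≤ t' → t' ≤ T → fbar t' ≤ fbar t + K * (t' - t) := by
    intro t t' h0 h1 h2
    have h3 := hstep t t' h0 h1 h2 t ⟨le_rfl, h1⟩
    have h4 := hle t (h1.trans h2) t ⟨h0, le_rfl⟩
    have h5 := mul_nonneg hK0 (sub_nonneg.2 h1)
    refine h3.trans (max_le ?_ ?_) <;> linarith
  -- basic facts on `ℓhat`
  set A : ℝ → Set ℝ := fun s => {l | l ∈ Set.Icc L0 L ∧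
      ENNReal.ofReal (s ^ 2) * Gr l < ENNReal.ofReal (Gc l)} with hA
  have hhat : ∀ s, ℓhat s = sInf (A s) := fun s => by rw [hℓhat]
  have hGcpos : ∀ l ∈ Set.Icc L0 L, 0 < Gc l := by
    intro l hl
    rcases hGcv l ⟨hL0.trans_le hl.1, hl.2⟩ with h | h <;> rw [h] <;> assumption
  have hLA : ∀ s, L ∈ A s := fun s => by
    refine ⟨⟨hL0L.le, le_rfl⟩, ?_⟩
    rw [hGrL, mul_zero]
    exact ENNReal.ofReal_pos.2 (hGcpos L ⟨hL0L.le, le_rfl⟩)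
  have hAbdd : ∀ s, BddBelow (A s) := fun s => ⟨L0, fun l hl => hl.1.1⟩
  have hhatle : ∀ s, ∀ l ∈ A s, ℓhat s ≤ l := fun s l hl => by
    rw [hhat]; exact csInf_le (hAbdd s) hl
  have hhatmem : ∀ s, ℓhat s ∈ Set.Icc L0 L := fun s =>
    ⟨by rw [hhat]; exact le_csInf ⟨L, hLA s⟩ (fun l hl => hl.1.1), hhatle s L (hLA s)⟩
  have hbelow : ∀ s l, L0 ≤ l → l < ℓhat s →
      ENNReal.ofReal (Gc l) ≤ ENNReal.ofReal (s ^ 2) * Gr l := by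
    intro s l h1 h2
    by_contra h
    exact absurd (hhatle s l ⟨⟨h1, h2.le.trans (hhatmem s).2⟩, not_le.1 h⟩) (not_le.2 h2)
  have hmulmono : ∀ s s' : ℝ, 0 ≤ s → s ≤ s' → ∀ l,
      ENNReal.ofReal (s ^ 2) * Gr l ≤ ENNReal.ofReal (s' ^ 2) * Gr l := by
    intro s s' h0 h1 l
    gcongr
  have hhatmono : ∀ s s', 0 ≤ s → s ≤ s' → ℓhat s ≤ ℓhat s' := by
    intro s s' h0 h1
    rw [hhat s']
    exact le_csInf ⟨L, hLA s'⟩ (fun l hl =>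
      hhatle s l ⟨hl.1, (hmulmono s s' h0 h1 l).trans_lt hl.2⟩)
  have hLamopen : IsOpen (Set.Ioo 0 L \ (Lam : Set ℝ)) :=
    isOpen_Ioo.sdiff Lam.finite_toSet.isClosed
  -- right lower semicontinuity of the energy release
  have hlsc : ∀ l ∈ Set.Ioo 0 L, ∀ c < Gr l, ∀ᶠ l' in 𝓝[>] l, c < Gr l' := by
    intro l hl c hc
    by_cases hlL : l ∈ (Lam : Set ℝ)
    · rw [hGrLam l hlL] at hc
      exact eventually_lt_of_lt_liminf hc
    · have hm : l ∈ Set.Ioo 0 L \ (Lam : Set ℝ) := ⟨hl, hlL⟩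
      have hcd : ContinuousAt (deriv E) l :=
        (hE1.continuousOn_deriv_of_isOpen hLamopen le_rfl).continuousAt (hLamopen.mem_nhds hm)
      have ht : Tendsto (fun x => ENNReal.ofReal (-(deriv E x))) (𝓝 l) (𝓝 (Gr l)) := by
        rw [hGr l hm]
        exact (ENNReal.continuous_ofReal.tendsto _).comp hcd.neg
      have h1 := (ht.eventually (lt_mem_nhds hc)).and (hLamopen.mem_nhds hm)
      refine (h1.filter_mono nhdsWithin_le_nhds).mono ?_
      rintro x ⟨hx1, hx2⟩
      rw [hGr x hx2]; exact hx1
  -- criterion (i) for `ℓhat`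
  have hi : ∀ s, ENNReal.ofReal (s ^ 2) * Gr (ℓhat s) ≤ ENNReal.ofReal (Gc (ℓhat s)) := by
    intro s
    by_cases hm : ℓhat s ∈ A s
    · exact hm.2.le
    by_contra hcon
    rw [not_le] at hcon
    have hlt : ℓhat s < L := lt_of_le_of_ne (hhatmem s).2 (fun h => hm (h ▸ hLA s))
    have hl : ℓhat s ∈ Set.Ioo 0 L := ⟨hL0.trans_le (hhatmem s).1, hlt⟩
    obtain ⟨c, hc1, hc2⟩ := exists_between hcon
    have h1 := hlsc _ hl _ (ENNReal.div_lt_of_lt_mul' hc2)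
    have h2 : ∀ᶠ l' in 𝓝[>] (ℓhat s), ENNReal.ofReal (Gc l') < c :=
      ((ENNReal.continuous_ofReal.tendsto _).comp (hGcrc _ hl)).eventually (gt_mem_nhds hc1)
    obtain ⟨u, hu, hu'⟩ := mem_nhdsGT_iff_exists_Ioo_subset.1 (h1.and h2)
    obtain ⟨l', hl', hl'u⟩ : ∃ l' ∈ A s, l' < u := by
      have : sInf (A s) < u := by rw [← hhat]; exact hu
      exact exists_lt_of_csInf_lt ⟨L, hLA s⟩ this
    have hne : ℓhat s ≠ l' := fun h => hm (h ▸ hl')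
    have h3 := hu' ⟨lt_of_le_of_ne (hhatle s l' hl') hne, hl'u⟩
    have hs0 : ENNReal.ofReal (s ^ 2) ≠ 0 := by
      intro h0
      rw [h0, zero_mul] at hc2
      exact not_lt_zero hc2
    have h4 : c < Gr l' * ENNReal.ofReal (s ^ 2) :=
      (ENNReal.div_lt_iff (Or.inl hs0) (Or.inl ENNReal.ofReal_ne_top)).1 h3.1
    have h5 := hl'.2
    rw [mul_comm] at h4
    exact absurd (h4.trans h5) (not_lt.2 h3.2.le)
  -- quadratic bound
  obtain ⟨C, hC0, hC⟩ : ∃ C : ℝ, 0 ≤ C ∧ ∀ s, ℓhat s - L0 ≤ C * s ^ 2 := by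
    have hc : 0 < min GA GB := lt_min hGA hGB
    have hEL : ∀ l ∈ Set.Icc L0 L, E L ≤ E l := fun l hl =>
      hEm ⟨hL0.trans_le hl.1, hl.2⟩ ⟨hL0.trans hL0L, le_rfl⟩ hl.2
    have hEL0 := hEL L0 ⟨le_rfl, hL0L.le⟩
    refine ⟨(E L0 - E L) / min GA GB, div_nonneg (by linarith) hc.le, fun s => ?_⟩
    have hmem := hhatmem s
    have key := griffith_finite_decrease Lam (fun x => s ^ 2 * E x + min GA GB * x) L0 (ℓhat s)
      hmem.1
      (by
        have : ContinuousOn E (Set.Icc L0 (ℓhat s)) :=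
          hEc.mono (fun x hx => ⟨hL0.trans_le hx.1, hx.2.trans hmem.2⟩)
        fun_prop)
      (by
        intro x hx hxL
        have hxm : x ∈ Set.Ioo 0 L \ (Lam : Set ℝ) :=
          ⟨⟨hL0.trans hx.1, hx.2.trans_le hmem.2⟩, hxL⟩
        have hdE : DifferentiableAt ℝ E x :=
          ((hE1.differentiableOn one_ne_zero) x hxm).differentiableAt (hLamopen.mem_nhds hxm)
        have hD : HasDerivAt (fun x => s ^ 2 * E x + min GA GB * x)
            (s ^ 2 * deriv E x + min GA GB * 1) x :=
          (hdE.hasDerivAt.const_mul _).add ((hasDerivAt_id x).const_mul _)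
        refine ⟨hD.differentiableAt, ?_⟩
        rw [hD.deriv]
        have hb := hbelow s x hx.1.le hx.2
        rw [hGr x hxm, ← ENNReal.ofReal_mul (sq_nonneg s)] at hb
        have hGx : min GA GB ≤ Gc x := by
          rcases hGcv x ⟨hxm.1.1, hxm.1.2.le⟩ with h | h <;> rw [h]
          · exact min_le_left _ _
          · exact min_le_right _ _
        have hb' := (ENNReal.ofReal_le_ofReal_iff').1 hb
        rcases hb' with hb' | hb' <;> linarith)
    have h1 := hEL _ hmem
    have h2 := mul_le_mul_of_nonneg_left h1 (sq_nonneg s)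
    rw [div_mul_eq_mul_div, le_div_iff₀ hc]
    nlinarith
  have hℓt : ∀ t, ℓ t = ℓhat (fbar t) := fun t => by rw [hℓ]
  have hmono : MonotoneOn ℓ (Set.Ico 0 T) := by
    intro t ht t' ht' h
    rw [hℓt, hℓt]
    exact hhatmono _ _ (hfb0 t ht.1 ht.2.le) (hfbmono t t' ht.1 h ht'.2.le)
  have hf00 : fbar 0 = 0 := by
    apply le_antisymm _ (hfb0 0 le_rfl hT.le)
    apply hlub 0 le_rfl
    intro τ hτ
    have : τ = 0 := le_antisymm hτ.2 hτ.1
    rw [this, hf0, abs_zero]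
  have hhat0 : ℓhat 0 = L0 := by
    have h1 := hC 0
    have h2 := (hhatmem 0).1
    norm_num at h1
    linarith
  -- zero load: derivative zero
  have hzero : ∀ t ∈ Set.Ico 0 T, fbar t = 0 → HasDerivWithinAt ℓ 0 (Set.Ico t T) t := by
    intro t ht h0
    rw [hasDerivWithinAt_iff_isLittleO]
    have hO : (fun x' => ℓ x' - ℓ t - (x' - t) • (0:ℝ)) =O[𝓝[Set.Ico t T] t]
        fun x' => (x' - t) ^ 2 := by
      refine Asymptotics.IsBigO.of_bound (C * K ^ 2) ?_
      filter_upwards [self_mem_nhdsWithin] with x hx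
      have h1 := hfblip t x ht.1 hx.1 hx.2.le
      have h2 := hfb0 x (ht.1.trans hx.1) hx.2.le
      have h3 := hC (fbar x)
      have h4 := (hhatmem (fbar x)).1
      rw [hℓt, hℓt, h0, hhat0, smul_zero, sub_zero, Real.norm_eq_abs, Real.norm_eq_abs,
        abs_of_nonneg (sub_nonneg.2 h4), abs_of_nonneg (sq_nonneg _), mul_assoc, ← mul_pow]
      rw [h0, zero_add] at h1
      exact h3.trans (mul_le_mul_of_nonneg_left (pow_le_pow_left₀ h2 h1 2) hC0)
    refine hO.trans_isLittleO ?_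
    have : (fun x : ℝ => (x - t) ^ 2) =o[𝓝 t] fun x => (x - t) := by
      have h1 : Tendsto (fun x : ℝ => x - t) (𝓝 t) (𝓝 0) := by
        have : Tendsto (fun x : ℝ => x - t) (𝓝 t) (𝓝 (t - t)) :=
          (continuous_id.sub continuous_const).tendsto t
        simpa using this
      exact (Asymptotics.isLittleO_pow_id one_lt_two).comp_tendsto h1
    exact this.mono nhdsWithin_le_nhds
  -- stability of membership
  have hstab : ∀ t ∈ Set.Ico 0 T, ∀ l ∈ A (fbar t), Gr l ≠ ⊤ →
      ∀ᶠ x in 𝓝[Set.Ico t T] t, l ∈ A (fbar x) := by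
    intro t ht l hl hfin
    have h1 : Tendsto (fun x => ENNReal.ofReal ((fbar t + K * (x - t)) ^ 2) * Gr l)
        (𝓝[Set.Ico t T] t) (𝓝 (ENNReal.ofReal ((fbar t + K * (t - t)) ^ 2) * Gr l)) := by
      refine Tendsto.mono_left ?_ nhdsWithin_le_nhds
      refine ENNReal.Tendsto.mul_const ?_ (Or.inr hfin)
      refine (ENNReal.continuous_ofReal.comp ?_).tendsto t
      fun_prop
    rw [sub_self, mul_zero, add_zero] at h1
    filter_upwards [h1.eventually (gt_mem_nhds hl.2), self_mem_nhdsWithin] with x hx hx'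
    exact ⟨hl.1, (hmulmono _ _ (hfb0 x (ht.1.trans hx'.1) hx'.2.le)
      (hfblip t x ht.1 hx'.1 hx'.2.le) l).trans_lt hx⟩
  have hfinA : ∀ s l, s ≠ 0 → ENNReal.ofReal (s ^ 2) * Gr l ≤ ENNReal.ofReal (Gc l) →
      Gr l ≠ ⊤ := by
    intro s l hs h h'
    have : ENNReal.ofReal (s ^ 2) ≠ 0 := by
      rw [Ne, ENNReal.ofReal_eq_zero, not_le]; positivity
    rw [h', ENNReal.mul_top this] at h
    exact ENNReal.ofReal_ne_top (top_le_iff.1 h)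
  have hconst : ∀ t ∈ Set.Ico 0 T, (∀ᶠ x in 𝓝[Set.Ico t T] t, ℓ x = ℓ t) →
      HasDerivWithinAt ℓ 0 (Set.Ico t T) t := by
    intro t ht h
    exact (hasDerivWithinAt_const t (Set.Ico t T) (ℓ t)).congr_of_eventuallyEq h rfl
  have habs : ∀ t ∈ Set.Ico 0 T, |f t| ≤ fbar t := fun t ht => hle t ht.2.le t ⟨ht.1, le_rfl⟩
  have hi' : ∀ t ∈ Set.Ico 0 T, ENNReal.ofReal (f t ^ 2) * Gr (ℓ t) ≤
      ENNReal.ofReal (fbar t ^ 2) * Gr (ℓ t) := by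
    intro t ht
    have := hmulmono _ _ (abs_nonneg _) (habs t ht) (ℓ t)
    rwa [sq_abs] at this
  refine ⟨hmono, ?_, ?_, ?_, ?_, ?_, ?_⟩
  · intro t ht
    have hsub : Set.Ioo t T ⊆ Set.Ico t T := Ioo_subset_Ico_self
    by_cases h0 : fbar t = 0
    · exact (hzero t ht h0).continuousWithinAt.mono hsub
    · refine Tendsto.mono_left ?_ (nhdsWithin_mono t hsub)
      rw [tendsto_order]
      constructor
      · intro a ha
        filter_upwards [self_mem_nhdsWithin] with x hx
        exact ha.trans_le (hmono ht ⟨ht.1.trans hx.1, hx.2⟩ hx.1)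
      · intro a ha
        rw [hℓt, hhat] at ha
        obtain ⟨l, hl, hla⟩ := exists_lt_of_csInf_lt ⟨L, hLA _⟩ ha
        filter_upwards [hstab t ht l hl (hfinA _ _ h0 hl.2.le)] with x hx
        rw [hℓt]
        exact (hhatle _ _ hx).trans_lt hla
  · rw [hℓt, hf00, hhat0]
  · intro t _
    rw [hℓt]; exact hhatmem _
  · intro t ht
    refine (hi' t ht).trans ?_
    rw [hℓt]; exact hi _
  · intro t ht hlt
    by_cases h0 : fbar t = 0
    · exact hzero t ht h0
    have hle' := hi (fbar t)
    have hfin := hfinA _ _ h0 hle'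
    apply hconst t ht
    by_cases hm : ℓhat (fbar t) ∈ A (fbar t)
    · filter_upwards [hstab t ht _ hm hfin, self_mem_nhdsWithin] with x hx hx'
      apply le_antisymm
      · rw [hℓt, hℓt]; exact hhatle _ _ hx
      · exact hmono ht ⟨ht.1.trans hx'.1, hx'.2⟩ hx'.1
    · have hft : |f t| < fbar t := by
        refine lt_of_le_of_ne (habs t ht) (fun h => hm ⟨hhatmem _, ?_⟩)
        rw [← sq_abs, h, hℓt] at hlt
        exact hlt
      have h1 : Tendsto (fun x => |f t| + K * (x - t)) (𝓝[Set.Ico t T] t)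
          (𝓝 (|f t| + K * (t - t))) := by
        refine Tendsto.mono_left ?_ nhdsWithin_le_nhds
        refine Continuous.tendsto ?_ t
        fun_prop
      rw [sub_self, mul_zero, add_zero] at h1
      filter_upwards [h1.eventually (gt_mem_nhds hft), self_mem_nhdsWithin] with x hx hx'
      have h2 := hstep t x ht.1 hx'.1 hx'.2.le t ⟨le_rfl, hx'.1⟩
      rw [max_eq_left hx.le] at h2
      rw [hℓt, hℓt, le_antisymm h2 (hfbmono t x ht.1 hx'.1 hx'.2.le)]
  · intro t ht hne l hl1 hl2
    by_cases ht0 : t = 0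
    · rw [if_pos ht0, ht0, hℓt, hf00, hhat0] at hne
      exact absurd rfl hne
    rw [if_neg ht0] at hne hl1
    have htpos : 0 < t := lt_of_le_of_ne ht.1 (Ne.symm ht0)
    have hB : ∀ y ∈ ℓ '' Set.Ico 0 t, y ≤ ℓ t := by
      rintro _ ⟨x, hx, rfl⟩
      exact hmono ⟨hx.1, hx.2.trans ht.2⟩ ht hx.2.le
    have hup : ∀ x ∈ Set.Ico 0 t, ℓ x ≤ sSup (ℓ '' Set.Ico 0 t) := fun x hx =>
      le_csSup ⟨ℓ t, hB⟩ ⟨x, hx, rfl⟩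
    have hft : |f t| = fbar t := by
      by_contra hcon
      have hft := lt_of_le_of_ne (habs t ht) hcon
      apply hne
      apply le_antisymm
      · exact csSup_le ⟨_, 0, ⟨le_rfl, htpos⟩, rfl⟩ hB
      · obtain ⟨x, hx, hxf⟩ : ∃ x ∈ Set.Ico 0 t, |f t| + K * (t - x) < fbar t := by
          have h1 : Tendsto (fun x => |f t| + K * (t - x)) (𝓝[<] t)
              (𝓝 (|f t| + K * (t - t))) := by
            refine Tendsto.mono_left ?_ nhdsWithin_le_nhds
            refine Continuous.tendsto (f := fun x => |f t| + K * (t - x)) ?_ t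
            fun_prop
          rw [sub_self, mul_zero, add_zero] at h1
          obtain ⟨x, hx1, hx2⟩ := ((h1.eventually (gt_mem_nhds hft)).and
            (Ico_mem_nhdsLT htpos)).exists
          exact ⟨x, hx2, hx1⟩
        have h2 := hstep x t hx.1 hx.2.le ht.2.le t ⟨hx.2.le, le_rfl⟩
        have h3 : fbar t ≤ fbar x := by
          rcases le_max_iff.1 h2 with h | h
          · exact h
          · exact absurd h (not_le.2 hxf)
        have h4 := le_antisymm h3 (hfbmono x t hx.1 hx.2.le ht.2.le)
        have h5 := hup x hx
        rwa [hℓt x, ← h4, ← hℓt] at h5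
    have hL0l : L0 ≤ l := by
      have h1 := hup 0 ⟨le_rfl, htpos⟩
      rw [hℓt, hf00, hhat0] at h1
      exact h1.trans hl1
    rw [hℓt] at hl2
    have := hbelow (fbar t) l hL0l hl2
    rwa [← hft, sq_abs] at this
end
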